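/- arXiv:1803.08906 — 2 statements merged into one kernel-verified Lean document; each statement's English description precedes it below -/
import Mathlib

section
/- Let G be an amenable group with a Følner net F = (F_i)_{i∈I}, let X be an irreducible algebraic variety over an algebraically closed field K, and let A := X(K). Suppose Γ ⊆ A^G is G-invariant (under the shift action) and satisfies: (D1) Γ is closed in A^G for the prodiscrete topology; (D2) Γ_Ω is Zariski-closed in A^Ω for every finite subset Ω ⊆ G; (D3) mdim_F(Γ) = dim(X). Then Γ = A^G. -/
open AlgebraicGeometry CategoryTheory CategoryTheory.Limits Filter Topology
open scoped ENNReal NNReal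

noncomputable section

namespace GOE

/-! ## Følner nets and amenability -/

/-- A (right) Følner net for a group `G`: a net of nonempty finite subsets `F i ⊆ G`,
indexed by a directed nonempty preorder, such that `|F i \ F i g| / |F i| → 0` for every
`g ∈ G`. -/
structure FolnerNet (G : Type) [Group G] where
  ι : Type
  [pre : Preorder ι]
  [ne : Nonempty ι]
  [dir : IsDirected ι (· ≤ ·)]
  F : ι → Finset G
  nonempty : ∀ i, (F i).Nonempty
  folner : ∀ g : G,
    Filter.Tendsto
      (fun i => ((((F i : Set G) \ ((· * g) '' (F i : Set G))).ncard : ℝ) / ((F i).card : ℝ)))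
      Filter.atTop (nhds 0)

attribute [instance] FolnerNet.pre FolnerNet.ne FolnerNet.dir

/-- A group is amenable if it admits a Følner net. -/
def Amenable (G : Type) [Group G] : Prop := Nonempty (FolnerNet G)

/-! ## Constructible subsets of a topological space -/

/-- A subset of a topological space is constructible if it is a finite union of
locally closed subsets. -/
def IsConstr {X : Type} [TopologicalSpace X] (C : Set X) : Prop :=
  ∃ (n : ℕ) (U Z : Fin n → Set X), (∀ i, IsOpen (U i)) ∧ (∀ i, IsClosed (Z i)) ∧
    C = ⋃ i, U i ∩ Z i

/-- Conversion of a Krull dimension (an element of `WithBot ℕ∞`) to an extended real. -/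
def dimE (d : WithBot ℕ∞) : EReal :=
  WithBot.recBotCoe ⊥ (fun n : ℕ∞ => ((n : ℝ≥0∞) : EReal)) d

/-! ## Varieties over a field and their points -/

variable (K : Type) [Field K]

/-- The spectrum of the field `K`, as a scheme. -/
abbrev SpecK : Scheme := Spec (CommRingCat.of K)

/-- The unique point of `Spec K`. -/
def specPt : SpecK K := (⟨⊥, Ideal.bot_prime⟩ : PrimeSpectrum K)

instance : HasFiniteProducts (Over (SpecK K)) :=
  CategoryTheory.Over.ConstructProducts.over_finiteProducts_of_finiteWidePullbacks

/-- The set of `K`-points of a `K`-scheme, i.e. sections of the structure morphism,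
i.e. morphisms `Spec K ⟶ X` over `Spec K`. -/
abbrev Pt (W : Over (SpecK K)) : Type := Over.mk (𝟙 (SpecK K)) ⟶ W

/-- The image in (the underlying space of) `W` of a `K`-point of `W`. -/
def ev {W : Over (SpecK K)} (a : Pt K W) : W.left := a.left.base (specPt K)

/-- The fibered power `X^Ω` over `Spec K` of a `K`-scheme `X`, for a finite index set `Ω`. -/
def pow (V : Over (SpecK K)) (Ω : Type) [Finite Ω] : Over (SpecK K) :=
  ∏ᶜ (fun _ : Ω => V)

/-- The canonical identification of families of `K`-points indexed by `Ω` with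
`K`-points of the fibered power `X^Ω`. -/
def ptPow (V : Over (SpecK K)) (Ω : Type) [Finite Ω] (a : Ω → Pt K V) :
    Pt K (pow K V Ω) := Pi.lift a

variable (V : Over (SpecK K))

/-- The Krull dimension of (the underlying space of) a `K`-scheme. -/
def vdim : WithBot ℕ∞ := topologicalKrullDim V.left

/-- The Zariski topology on `A^Ω` (`A` the set of `K`-points of `X`), induced from the
Zariski topology of the fibered power `X^Ω` via the identification of `A^Ω` with a
subset (the set of closed points, for `K` algebraically closed) of `X^Ω`. -/
def cfgTop (Ω : Type) [Finite Ω] : TopologicalSpace (Ω → Pt K V) :=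
  TopologicalSpace.induced (fun u => ev K (ptPow K V Ω u)) inferInstance

/-- The Krull dimension of a subset `D ⊆ A^Ω` for the Zariski topology. -/
def cfgDim (Ω : Type) [Finite Ω] (D : Set (Ω → Pt K V)) : WithBot ℕ∞ :=
  letI := cfgTop K V Ω
  topologicalKrullDim D

/-- `D ⊆ A^Ω` is closed for the Zariski topology. -/
def cfgClosed (Ω : Type) [Finite Ω] (D : Set (Ω → Pt K V)) : Prop :=
  letI := cfgTop K V Ω
  IsClosed D

/-- `D ⊆ A^Ω` is constructible for the Zariski topology. -/
def cfgConstr (Ω : Type) [Finite Ω] (D : Set (Ω → Pt K V)) : Prop :=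
  letI := cfgTop K V Ω
  IsConstr D

/-! ## Configurations, restrictions, cylinders -/

variable {G : Type} [Group G]

/-- The restriction `Γ_Ω ⊆ A^Ω` of a set of configurations `Γ ⊆ A^G`. -/
def restr (Γ : Set (G → Pt K V)) (Ω : Finset G) : Set (↥Ω → Pt K V) :=
  (fun c (ω : ↥Ω) => c ω) '' Γ

/-- The cylinder `D_p ⊆ A^G`: configurations restricting to an element of `D` on `Ω` and
to `p` on `G ∖ Ω`. -/
def cyl (Ω : Finset G) (D : Set (↥Ω → Pt K V)) (p : {g : G // g ∉ Ω} → Pt K V) :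
    Set (G → Pt K V) :=
  {c | (fun ω : ↥Ω => c ω) ∈ D ∧ ∀ (g : G) (h : g ∉ Ω), c g = p ⟨g, h⟩}

/-- Algebraic mean dimension of `Γ ⊆ A^G` with respect to a Følner net. -/
def mdim (𝓕 : FolnerNet G) (Γ : Set (G → Pt K V)) : EReal :=
  Filter.limsup
    (fun i => dimE (cfgDim K V ↥(𝓕.F i) (restr K V Γ (𝓕.F i))) *
      ((((𝓕.F i).card : ℝ)⁻¹ : ℝ) : EReal))
    Filter.atTop

/-! ## Cellular automata -/

/-- `τ : A^G → A^G` is an algebraic cellular automaton over `(G, X, K)`: it admits a finite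
memory set `M ⊆ G` whose associated local defining map `A^M → A` is induced by a morphism
of `K`-schemes `f : X^M → X`. -/
def IsAlgCA (τ : (G → Pt K V) → (G → Pt K V)) : Prop :=
  ∃ (M : Finset G) (f : pow K V ↥M ⟶ V),
    ∀ (x : G → Pt K V) (g : G),
      τ x g = ptPow K V ↥M (fun m => x (g * (m : G))) ≫ f

/-- Pre-injectivity: configurations that are almost equal and have the same image are equal. -/
def PreInjective (τ : (G → Pt K V) → (G → Pt K V)) : Prop :=
  ∀ c₁ c₂ : G → Pt K V, {g : G | c₁ g ≠ c₂ g}.Finite → τ c₁ = τ c₂ → c₁ = c₂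

/-- `(*)`-pre-injectivity: there exist no finite subset `Ω ⊆ G` and Zariski-closed proper
subset `H ⊊ A^Ω` such that `τ((A^Ω)_p) = τ(H_p)` for all `p ∈ A^{G∖Ω}`. -/
def StarPreInjective (τ : (G → Pt K V) → (G → Pt K V)) : Prop :=
  ¬ ∃ (Ω : Finset G) (H : Set (↥Ω → Pt K V)), cfgClosed K V ↥Ω H ∧ H ≠ Set.univ ∧
      ∀ p : {g : G // g ∉ Ω} → Pt K V,
        τ '' cyl K V Ω Set.univ p = τ '' cyl K V Ω H p

/-- `(**)`-pre-injectivity: there is no finite subset `Ω ⊆ G` such that, for every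
`p ∈ A^{G∖Ω}`, the finite-support set `τ((A^Ω)_p)` (written as some `R_s`) satisfies
`dim(R) < dim(A^Ω)`. -/
def StarStarPreInjective (τ : (G → Pt K V) → (G → Pt K V)) : Prop :=
  ¬ ∃ Ω : Finset G, ∀ p : {g : G // g ∉ Ω} → Pt K V,
      ∃ (Λ : Finset G) (R : Set (↥Λ → Pt K V)) (s : {g : G // g ∉ Λ} → Pt K V),
        τ '' cyl K V Ω Set.univ p = cyl K V Λ R s ∧
        cfgDim K V ↥Λ R < cfgDim K V ↥Ω (Set.univ : Set (↥Ω → Pt K V))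

/-- `Γ ⊆ A^G` is closed for the prodiscrete topology on `A^G`. -/
def ProdiscreteClosed {A : Type} (Γ : Set (G → A)) : Prop :=
  letI : TopologicalSpace A := ⊥
  IsClosed Γ

/-- `Γ ⊆ A^G` is invariant under the shift action of `G`. -/
def ShiftInvariant {A : Type} (Γ : Set (G → A)) : Prop :=
  ∀ (g : G), ∀ c ∈ Γ, (fun h : G => c (g⁻¹ * h)) ∈ Γ

/-- An `(E,E')`-tiling of `G`. -/
def IsTiling (E E' : Finset G) (T : Set G) : Prop :=
  (∀ g ∈ T, ∀ h ∈ T, g ≠ h →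
    Disjoint ((g * ·) '' (E : Set G)) ((h * ·) '' (E : Set G))) ∧
  ∀ x : G, ∃ g ∈ T, x ∈ (g * ·) '' (E' : Set G)


theorem ringKrullDim_le_of_isIntegral {R S : Type*} [CommRing R] [CommRing S] (f : R →+* S)
    (hf : f.IsIntegral) : ringKrullDim S ≤ ringKrullDim R := by
  algebraize [f]
  exact Order.krullDim_le_of_strictMono (PrimeSpectrum.comap f)
    fun I J h => Ideal.IsIntegral.comap_lt_comap (R := R) (I := I.asIdeal) (J := J.asIdeal) h

theorem ringKrullDim_le_of_isIntegral_of_injective {R S : Type*} [CommRing R] [CommRing S]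
    (f : R →+* S) (hf : f.IsIntegral) (hinj : Function.Injective f) :
    ringKrullDim R ≤ ringKrullDim S := by
  algebraize [f]
  have key : ∀ p : LTSeries (PrimeSpectrum R), ∃ q : LTSeries (PrimeSpectrum S),
      q.length = p.length ∧ PrimeSpectrum.comap f q.last = p.last := by
    intro p
    induction p using RelSeries.inductionOn' with
    | singleton x =>
      obtain ⟨Q, -, hQ, hQx⟩ := Ideal.exists_ideal_over_prime_of_isIntegral (S := S) x.asIdeal ⊥
        (by
          have hker : RingHom.ker (algebraMap R S) = ⊥ :=
            (RingHom.injective_iff_ker_eq_bot _).mp hinj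
          rw [← RingHom.ker_eq_comap_bot, hker]
          exact bot_le)
      exact ⟨RelSeries.singleton _ ⟨Q, hQ⟩, rfl, PrimeSpectrum.ext hQx⟩
    | snoc p x hx ih =>
      obtain ⟨q, hq, hqx⟩ := ih
      have hlt : p.last < x := hx
      obtain ⟨Q, hle, hQ, hQx⟩ := Ideal.exists_ideal_over_prime_of_isIntegral (S := S) x.asIdeal
        q.last.asIdeal (by
          have := hlt.le
          rw [← hqx] at this
          exact this)
      have hlt' : q.last < ⟨Q, hQ⟩ := by
        refine lt_of_le_of_ne hle fun h => hlt.ne ?_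
        rw [← hqx, h]
        exact PrimeSpectrum.ext hQx
      refine ⟨q.snoc ⟨Q, hQ⟩ hlt', by simp [hq], ?_⟩
      simp only [RelSeries.last_snoc]
      exact PrimeSpectrum.ext hQx
  refine iSup_le fun p => ?_
  obtain ⟨q, hq, -⟩ := key p
  rw [← hq]
  exact le_iSup (fun q : LTSeries (PrimeSpectrum S) => (q.length : WithBot ℕ∞)) q

/-- The dimension of an algebra generated by finitely many finitely generated algebras is at most
the sum of their dimensions. -/
theorem ringKrullDim_add_sum_le_of_iSup_range_eq_top {K J B : Type*} [Field K] [Finite J] [CommRing B]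
    [Algebra K B] {S : J → Type*} [∀ j, CommRing (S j)] [∀ j, Algebra K (S j)]
    [∀ j, Algebra.FiniteType K (S j)] (f : ∀ j, S j →ₐ[K] B)
    (hf : ⨆ j, (f j).range = ⊤) (t : Finset J) (ht : ∀ j, j ∈ t) (c m : J → ℕ)
    (hdim : ∀ j, ringKrullDim (S j) + c j ≤ m j) :
    ringKrullDim B + (∑ j ∈ t, c j : ℕ) ≤ (∑ j ∈ t, m j : ℕ) := by
  nontriviality B
  have : ∀ j, Nontrivial (S j) := fun j => (f j).toRingHom.domain_nontrivial
  choose e g hinj hint using fun j => exists_integral_inj_algHom_of_fg K (S j)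
  have hem : ∀ j, e j + c j ≤ m j := fun j => by
    have h1 := ringKrullDim_le_of_isIntegral_of_injective (g j).toRingHom (hint j) (hinj j)
    rw [MvPolynomial.ringKrullDim_of_isNoetherianRing, ringKrullDim_eq_zero_of_field] at h1
    have h2 := (add_le_add_left h1 (c j : WithBot ℕ∞)).trans (hdim j)
    rw [zero_add, Nat.card_fin] at h2
    exact_mod_cast h2
  let φ : MvPolynomial (Σ j, Fin (e j)) K →ₐ[K] B :=
    MvPolynomial.aeval fun x => f x.1 (g x.1 (MvPolynomial.X x.2))
  have hφ : ∀ j, φ.comp (MvPolynomial.rename (Sigma.mk j)) = (f j).comp (g j) := fun j => by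
    ext i
    simp [φ]
  have hφint : φ.toRingHom.IsIntegral := by
    algebraize [φ.toRingHom]
    have : ∀ b : B, b ∈ (⨆ j, (f j).range) → IsIntegral (MvPolynomial (Σ j, Fin (e j)) K) b := by
      suffices h : (⨆ j, (f j).range) ≤
          (integralClosure (MvPolynomial (Σ j, Fin (e j)) K) B).restrictScalars K from fun b hb => h hb
      refine iSup_le fun j => ?_
      rintro _ ⟨s, rfl⟩
      obtain ⟨p, hp, hp'⟩ := hint j s
      refine ⟨p.map (MvPolynomial.rename (Sigma.mk j)).toRingHom, hp.map _, ?_⟩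
      have hcomp : (algebraMap (MvPolynomial (Σ j, Fin (e j)) K) B).comp
          (MvPolynomial.rename (Sigma.mk j)).toRingHom = (f j).toRingHom.comp (g j).toRingHom :=
        congrArg AlgHom.toRingHom (hφ j)
      rw [Polynomial.eval₂_map]
      erw [hcomp]
      have := congrArg (f j).toRingHom hp'
      rw [Polynomial.hom_eval₂, map_zero] at this
      exact this
    intro b
    exact this b (hf ▸ Algebra.mem_top)
  have hB := ringKrullDim_le_of_isIntegral _ hφint
  rw [MvPolynomial.ringKrullDim_of_isNoetherianRing, ringKrullDim_eq_zero_of_field, zero_add] at hB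
  have hcard : Nat.card (Σ j, Fin (e j)) = ∑ j ∈ t, e j := by
    classical
    have : Fintype J := Fintype.ofFinite J
    have : t = Finset.univ := by ext; simp [ht]
    simp [this]
  calc ringKrullDim B + (∑ j ∈ t, c j : ℕ)
      ≤ ((∑ j ∈ t, e j : ℕ) : WithBot ℕ∞) + (∑ j ∈ t, c j : ℕ) := by
        gcongr; rwa [hcard] at hB
    _ ≤ (∑ j ∈ t, m j : ℕ) := by
        rw [← Nat.cast_add, ← Finset.sum_add_distrib]
        exact_mod_cast Finset.sum_le_sum fun j _ => hem j

theorem exists_ringKrullDim_le_of_finiteType (K S : Type*) [Field K] [CommRing S] [Algebra K S]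
    [Algebra.FiniteType K S] : ∃ n : ℕ, ringKrullDim S ≤ n := by
  cases subsingleton_or_nontrivial S
  · exact ⟨0, by simp [ringKrullDim_eq_bot_of_subsingleton]⟩
  obtain ⟨n, g, -, hg⟩ := exists_integral_inj_algHom_of_fg K S
  refine ⟨n, (ringKrullDim_le_of_isIntegral _ hg).trans ?_⟩
  rw [MvPolynomial.ringKrullDim_of_isNoetherianRing, ringKrullDim_eq_zero_of_field]
  simp

theorem topologicalKrullDim_le_of_open_cover {Y : Type*} [TopologicalSpace Y] {n : WithBot ℕ∞}
    (h : ∀ y : Y, ∃ U : Set Y, IsOpen U ∧ y ∈ U ∧ topologicalKrullDim U ≤ n) :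
    topologicalKrullDim Y ≤ n := by
  refine iSup_le fun p => ?_
  obtain ⟨y, hy⟩ := p.head.isIrreducible.nonempty
  obtain ⟨U, hU, hyU, hn⟩ := h y
  refine le_trans ?_ hn
  have hmem : ∀ i, y ∈ (p i : Set Y) := fun i => p.head_le i hy
  let e := TopologicalSpace.IrreducibleCloseds.orderIsoOfIsOpenEmbedding
    (Subtype.val : U → Y) hU.isOpenEmbedding_subtypeVal
  let q : LTSeries (TopologicalSpace.IrreducibleCloseds U) :=
    { length := p.length
      toFun := fun i => e.symm ⟨p i, ⟨⟨y, hyU⟩, hmem i⟩⟩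
      step := fun i => e.symm.strictMono (p.step i) }
  exact le_iSup (fun q : LTSeries (TopologicalSpace.IrreducibleCloseds U) =>
    (q.length : WithBot ℕ∞)) q

/-- A finite power of an irreducible space is irreducible for any topology for which the
one-variable substitutions are continuous. -/
theorem isPreirreducible_univ_pi_of_continuous_update {A E : Type*} [Finite E] [DecidableEq E]
    [TopologicalSpace A] [PreirreducibleSpace A] [TopologicalSpace (E → A)]
    (h : ∀ (u : E → A) (e : E), Continuous fun a => Function.update u e a) :
    IsPreirreducible (Set.univ : Set (E → A)) := by
  rw [isPreirreducible_iff_isClosed_union_isClosed]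
  intro Z₁ Z₂ h₁ h₂ hZ
  have : Fintype E := Fintype.ofFinite E
  have key : ∀ (S : Finset E) (u : E → A), (∀ v, (∀ e ∉ S, v e = u e) → v ∈ Z₁) ∨
      (∀ v, (∀ e ∉ S, v e = u e) → v ∈ Z₂) := by
    intro S
    induction S using Finset.induction_on with
    | empty =>
      intro u
      refine (hZ (Set.mem_univ u)).imp ?_ ?_ <;>
      · intro hu v hv
        rwa [show v = u from funext fun e => hv e (by simp)]
    | insert e S he ih =>
      intro u
      let C (Z : Set (E → A)) : Set A :=
        ⋂ v : {v : E → A // ∀ e' ∉ insert e S, v e' = u e'}, (fun a => Function.update v.1 e a) ⁻¹' Z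
      have hC : ∀ Z, IsClosed Z → IsClosed (C Z) := fun Z hZ =>
        isClosed_iInter fun v => hZ.preimage (h v.1 e)
      have hCmem : ∀ Z a, (∀ v, (∀ e' ∉ S, v e' = Function.update u e a e') → v ∈ Z) → a ∈ C Z := by
        intro Z a hv
        refine Set.mem_iInter.mpr fun v => hv _ fun e' he' => ?_
        by_cases hee : e' = e
        · subst hee; simp
        · simp only [Function.update_of_ne hee]
          exact v.2 e' (by simp [hee, he'])
      have hcov : (Set.univ : Set A) ⊆ C Z₁ ∪ C Z₂ := fun a _ =>
        (ih (Function.update u e a)).imp (hCmem Z₁ a) (hCmem Z₂ a)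
      refine ((isPreirreducible_iff_isClosed_union_isClosed.mp
        (PreirreducibleSpace.isPreirreducible_univ (X := A))) _ _ (hC _ h₁) (hC _ h₂) hcov).imp
          ?_ ?_ <;>
      · intro hsub v hv
        have := Set.mem_iInter.mp (hsub (Set.mem_univ (v e))) ⟨v, hv⟩
        simpa using this
  by_cases hne : Nonempty (E → A)
  · obtain ⟨u⟩ := hne
    exact (key Finset.univ u).imp (fun hu v _ => hu v (by simp)) (fun hu v _ => hu v (by simp))
  · exact Or.inl fun u _ => (hne ⟨u⟩).elim

theorem FolnerNet.exists_disjoint_translates {G : Type} [Group G] [DecidableEq G] (𝓕 : FolnerNet G)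
    (Ω : Finset G) (hΩ : 1 ∈ Ω) : ∃ c : ℝ, 0 < c ∧ ∀ᶠ i in atTop, ∃ T : Finset G,
      (∀ g ∈ T, Ω.image (g * ·) ⊆ 𝓕.F i) ∧
      (T : Set G).PairwiseDisjoint (fun g => Ω.image (g * ·)) ∧
      c * (𝓕.F i).card ≤ T.card := by
  classical
  have hpos : (0 : ℝ) < Ω.card := by exact_mod_cast Finset.card_pos.mpr ⟨1, hΩ⟩
  refine ⟨1 / (2 * Ω.card ^ 2), by positivity, ?_⟩
  have hev : ∀ᶠ i in atTop, ∀ ω ∈ Ω,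
      ((((𝓕.F i : Set G) \ ((· * ω⁻¹) '' (𝓕.F i : Set G))).ncard : ℝ) / ((𝓕.F i).card : ℝ))
        < 1 / (2 * Ω.card) :=
    (Finset.eventually_all Ω).mpr fun ω _ =>
      (𝓕.folner ω⁻¹).eventually (gt_mem_nhds (by positivity))
  filter_upwards [hev] with i hi
  set F := 𝓕.F i
  have hF : (0 : ℝ) < F.card := by exact_mod_cast Finset.card_pos.mpr (𝓕.nonempty i)
  let H := F.filter fun g => ∀ ω ∈ Ω, g * ω ∈ F
  have hcompl : F \ H ⊆ Ω.biUnion fun ω => F.filter fun g => g * ω ∉ F := by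
    intro g hg
    simp only [H, Finset.mem_sdiff, Finset.mem_filter, not_and, not_forall] at hg
    obtain ⟨ω, hω, h⟩ := hg.2 hg.1
    simp only [Finset.mem_biUnion, Finset.mem_filter]
    exact ⟨ω, hω, hg.1, h⟩
  have hcard : ∀ ω ∈ Ω, ((F.filter fun g => g * ω ∉ F).card : ℝ) ≤ F.card / (2 * Ω.card) := by
    intro ω hω
    have h := hi ω hω
    rw [div_lt_iff₀ hF] at h
    have heq : ((F : Set G) \ ((· * ω⁻¹) '' (F : Set G))) =
        ((F.filter fun g => g * ω ∉ F : Finset G) : Set G) := by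
      ext g
      simp only [Set.image_mul_right, inv_inv, Set.mem_sdiff, Set.mem_preimage, Finset.coe_filter,
        Set.mem_ofPred_eq, Finset.mem_coe]
    rw [heq, Set.ncard_coe_finset] at h
    calc _ ≤ _ := h.le
      _ = _ := by ring
  have hH : (F.card : ℝ) / 2 ≤ H.card := by
    have h1 : (F.card : ℝ) = (F \ H).card + H.card := by
      exact_mod_cast (Finset.card_sdiff_add_card_eq_card (Finset.filter_subset _ F)).symm
    have h2 : ((F \ H).card : ℝ) ≤ ∑ ω ∈ Ω, ((F.filter fun g => g * ω ∉ F).card : ℝ) := by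
      exact_mod_cast (Finset.card_le_card hcompl).trans Finset.card_biUnion_le
    have h3 := Finset.sum_le_sum hcard
    rw [Finset.sum_const, nsmul_eq_mul] at h3
    have h4 : (Ω.card : ℝ) * (F.card / (2 * Ω.card)) = F.card / 2 := by field_simp
    linarith
  let P := H.powerset.filter fun T : Finset G =>
    (T : Set G).PairwiseDisjoint (fun g => Ω.image (g * ·))
  obtain ⟨T, hT, hmax⟩ := Finset.exists_max_image P Finset.card ⟨∅, by simp [P]⟩
  simp only [P, Finset.mem_filter, Finset.mem_powerset] at hT hmax
  refine ⟨T, fun g hg x hx => ?_, hT.2, ?_⟩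
  · obtain ⟨ω, hω, rfl⟩ := Finset.mem_image.mp hx
    exact (Finset.mem_filter.mp (hT.1 hg)).2 ω hω
  have hcover : H ⊆ T.biUnion fun g => (Ω ×ˢ Ω).image fun p => g * p.1 * p.2⁻¹ := by
    intro h hh
    simp only [Finset.mem_biUnion, Finset.mem_image, Finset.mem_product, Prod.exists]
    by_contra hcon
    have hhT : h ∉ T := fun hT' => hcon ⟨h, hT', 1, 1, ⟨hΩ, hΩ⟩, by simp⟩
    have hmem := hmax (insert h T) ⟨Finset.insert_subset hh hT.1, by
      rw [Finset.coe_insert]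
      refine hT.2.insert fun g hg _ => Finset.disjoint_left.mpr fun x hx hx' => hcon ?_
      obtain ⟨a, ha, rfl⟩ := Finset.mem_image.mp hx
      obtain ⟨b, hb, hab⟩ := Finset.mem_image.mp hx'
      exact ⟨g, hg, b, a, ⟨hb, ha⟩, by rw [hab]; simp⟩⟩
    rw [Finset.card_insert_of_notMem hhT] at hmem
    omega
  have hle : (H.card : ℝ) ≤ T.card * Ω.card ^ 2 := by
    have h1 := (Finset.card_le_card hcover).trans (Finset.card_biUnion_le_card_mul T _ (Ω.card ^ 2)
      fun g _ => Finset.card_image_le.trans (by rw [Finset.card_product, sq]))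
    exact_mod_cast h1
  rw [one_div_mul_eq_div, div_le_iff₀ (by positivity)]
  linarith

theorem dimE_natCast (k : ℕ) : dimE (k : WithBot ℕ∞) = ((k : ℝ) : EReal) := by
  change (((k : ℕ∞) : ℝ≥0∞) : EReal) = _
  rw [ENat.toENNReal_coe, ← ENNReal.coe_natCast, EReal.coe_nnreal_eq_coe_real, NNReal.coe_natCast]

theorem dimE_mul_inv_le {D : WithBot ℕ∞} {n N f : ℕ} {c : ℝ} (hf : 0 < f)
    (hD : D + N ≤ (n * f : ℕ)) (hN : c * f ≤ N) :
    dimE D * (((f : ℝ)⁻¹ : ℝ) : EReal) ≤ ((n - c : ℝ) : EReal) := by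
  have hf' : (0 : ℝ) < f := by exact_mod_cast hf
  induction D using WithBot.recBotCoe with
  | bot =>
    have : dimE ⊥ = ⊥ := rfl
    rw [this, EReal.bot_mul_coe_of_pos (by positivity)]
    exact bot_le
  | coe D =>
    induction D using ENat.recTopCoe with
    | top =>
      exfalso
      have : ((⊤ : ℕ∞) + (N : ℕ∞) : ℕ∞) ≤ (n * f : ℕ) := WithBot.coe_le_coe.mp (by exact_mod_cast hD)
      simp at this
      exact absurd this (by exact_mod_cast ENat.natCast_ne_top (n * f))
    | coe k =>
      have hk : k + N ≤ n * f := by exact_mod_cast hD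
      have hk' : (k : ℝ) + N ≤ n * f := by exact_mod_cast hk
      have : dimE ((k : ℕ∞) : WithBot ℕ∞) = ((k : ℝ) : EReal) := dimE_natCast k
      rw [this, ← EReal.coe_mul, EReal.coe_le_coe_iff, ← div_eq_mul_inv, div_le_iff₀ hf']
      linarith

theorem appLE_comp_appLE_eq_id {X Z : Scheme} {f : X ⟶ Z} {a : Z ⟶ X} (h : a ≫ f = 𝟙 Z)
    (U : X.Opens) (h₁ : U ≤ f ⁻¹ᵁ ⊤) (h₂ : ⊤ ≤ a ⁻¹ᵁ U) :
    f.appLE ⊤ U h₁ ≫ a.appLE U ⊤ h₂ = 𝟙 _ := by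
  rw [Scheme.Hom.appLE_comp_appLE]
  have key : ∀ (g : Z ⟶ Z) (e : ⊤ ≤ g ⁻¹ᵁ ⊤), g = 𝟙 Z → g.appLE ⊤ ⊤ e = 𝟙 _ := by
    rintro g e rfl
    rw [Scheme.Hom.appLE]
    exact (Category.id_comp _).trans (Z.presheaf.map_id _)
  exact key _ _ h

section Points

variable {K} {W W' : Over (SpecK K)}

theorem top_le_preimage_of_ev_mem {a : Pt K W} {U : W.left.Opens} (h : ev K a ∈ U) :
    (⊤ : (SpecK K).Opens) ≤ a.left ⁻¹ᵁ U := by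
  intro x _
  rwa [show x = specPt K from Subsingleton.elim (α := PrimeSpectrum K) _ _]

instance sectionAlgebra (U : W.left.Opens) : Algebra K Γ(W.left, U) :=
  ((Scheme.ΓSpecIso (.of K)).inv ≫ Scheme.Hom.appLE (X := W.left) (Y := SpecK K) W.hom ⊤ U
    le_top).hom.toAlgebra

/-- Evaluation of sections at a `K`-point. -/
def evalAt (a : Pt K W) (U : W.left.Opens) (h : ev K a ∈ U) : Γ(W.left, U) →ₐ[K] K where
  __ := (Scheme.Hom.appLE (X := SpecK K) a.left U ⊤ (top_le_preimage_of_ev_mem h) ≫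
    (Scheme.ΓSpecIso (.of K)).hom).hom
  commutes' k := by
    have h0 := appLE_comp_appLE_eq_id (X := W.left) (Z := SpecK K) (Over.w a) U le_top
      (top_le_preimage_of_ev_mem h)
    have h1 := congrArg (fun φ => (Scheme.ΓSpecIso (.of K)).hom.hom
      (φ.hom ((Scheme.ΓSpecIso (.of K)).inv.hom k))) h0
    exact h1.trans (congrArg (fun φ => φ.hom k) (Scheme.ΓSpecIso (.of K)).inv_hom_id)

theorem evalAt_ne_zero_iff (a : Pt K W) (U : W.left.Opens) (h : ev K a ∈ U) (f : Γ(W.left, U)) :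
    evalAt a U h f ≠ 0 ↔ ev K a ∈ W.left.basicOpen f := by
  let g := Scheme.Hom.appLE (X := SpecK K) a.left U ⊤ (top_le_preimage_of_ev_mem h) f
  let e := (Scheme.ΓSpecIso (.of K)).commRingCatIsoToRingEquiv
  have h1 : evalAt a U h f = e g := rfl
  have h2 : ev K a ∈ W.left.basicOpen f ↔ specPt K ∈ (SpecK K).basicOpen g := by
    rw [Scheme.basicOpen_appLE]
    exact ⟨fun h => ⟨trivial, h⟩, fun h => h.2⟩
  rw [h1, h2]
  constructor
  · intro hne
    have : IsUnit g := (isUnit_map_iff e g).mp hne.isUnit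
    rw [Scheme.basicOpen_of_isUnit _ this]
    trivial
  · rintro hmem h0
    rw [(map_eq_zero_iff e e.injective).mp h0, Scheme.basicOpen_zero] at hmem
    exact hmem

theorem evalAt_comp (a : Pt K W) (g : W ⟶ W') (U : W.left.Opens) (U' : W'.left.Opens)
    (hU : U ≤ g.left ⁻¹ᵁ U') (h : ev K a ∈ U) (h' : ev K (a ≫ g) ∈ U') (f : Γ(W'.left, U')) :
    evalAt (a ≫ g) U' h' f = evalAt a U h (g.left.appLE U' U hU f) := by
  have h1 : g.left.appLE U' U hU ≫ Scheme.Hom.appLE (X := SpecK K) a.left U ⊤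
      (top_le_preimage_of_ev_mem h) = Scheme.Hom.appLE (X := SpecK K) (a ≫ g).left U' ⊤
      (top_le_preimage_of_ev_mem h') :=
    Scheme.Hom.appLE_comp_appLE _ _ _ _ _ _ _
  have h2 := congrArg (fun φ => (Scheme.ΓSpecIso (.of K)).hom (φ.hom f)) h1
  exact h2.symm

end Points

section FunctionAlgebra

variable {K} {W : Over (SpecK K)} {V} {E : Type} [Finite E]

/-- The projection from a fibered power to a factor. -/
def powProj (e : E) : pow K V E ⟶ V := Pi.π (fun _ : E => V) e

theorem ptPow_comp_powProj (u : E → Pt K V) (e : E) : ptPow K V E u ≫ powProj e = u e :=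
  Pi.lift_π _ _

/-- Evaluation of sections along a family of `K`-points. -/
def evalFun {T : Type} (x : T → Pt K W) (U : W.left.Opens) (hx : ∀ t, ev K (x t) ∈ U) :
    Γ(W.left, U) →ₐ[K] (T → K) :=
  AlgHom.pi fun t => evalAt (x t) U (hx t)

theorem SpecMap_evalAt_fromSpec {U : W.left.Opens} (hU : IsAffineOpen U) (a : Pt K W)
    (h : ev K a ∈ U) :
    Spec.map (CommRingCat.ofHom (evalAt a U h).toRingHom) ≫ hU.fromSpec = a.left := by
  have h1 := IsAffineOpen.SpecMap_appLE_fromSpec (X := SpecK K) a.left hU (isAffineOpen_top _)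
    (top_le_preimage_of_ev_mem h)
  have h2 : CommRingCat.ofHom (evalAt a U h).toRingHom = Scheme.Hom.appLE (X := SpecK K) a.left U ⊤
      (top_le_preimage_of_ev_mem h) ≫ (Scheme.ΓSpecIso (.of K)).hom := rfl
  rw [h2, Spec.map_comp, Category.assoc, h1, IsAffineOpen.fromSpec_top, Scheme.isoSpec_Spec_inv,
    ← Category.assoc, ← Spec.map_comp, Iso.inv_hom_id, Spec.map_id]
  exact Category.id_comp _

theorem fromSpec_comp_hom {U : W.left.Opens} (hU : IsAffineOpen U) :
    hU.fromSpec ≫ W.hom = Spec.map (CommRingCat.ofHom (algebraMap K Γ(W.left, U))) := by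
  have h1 := IsAffineOpen.SpecMap_appLE_fromSpec (X := W.left) (Y := SpecK K) W.hom
    (isAffineOpen_top _) hU le_top
  rw [IsAffineOpen.fromSpec_top, Scheme.isoSpec_Spec_inv, ← Spec.map_comp] at h1
  exact h1.symm

/-- The morphism from an affine scheme over `K` to an affine open subscheme. -/
def overSpecHom {B : Type} [CommRing B] [Algebra K B] {U : W.left.Opens} (hU : IsAffineOpen U)
    (φ : Γ(W.left, U) →ₐ[K] B) : Over.mk (Spec.map (CommRingCat.ofHom (algebraMap K B))) ⟶ W :=
  Over.homMk (Spec.map (CommRingCat.ofHom φ.toRingHom) ≫ hU.fromSpec) (by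
    change (Spec.map _ ≫ hU.fromSpec) ≫ W.hom = Spec.map _
    rw [Category.assoc, fromSpec_comp_hom hU, ← Spec.map_comp, ← CommRingCat.ofHom_comp]
    congr 2
    exact φ.comp_algebraMap)

variable {T : Type} (s : E → V.left.Opens) (τ : T → E → Pt K V)
  (h : ∀ t e, ev K (τ t e) ∈ s e)

/-- The algebra of functions generated by the sections over `s e` of the coordinate `e`. -/
def funAlg : Subalgebra K (T → K) :=
  ⨆ e, (evalFun (fun t => τ t e) (s e) fun t => h t e).range

/-- Evaluation of elements of the function algebra. -/
def funAlgEval (t : T) : funAlg s τ h →ₐ[K] K :=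
  (Pi.evalAlgHom K (fun _ : T => K) t).comp (funAlg s τ h).val

/-- The prime ideal of functions vanishing at a point. -/
def toPrimeSpectrum (t : T) : PrimeSpectrum (funAlg s τ h) :=
  PrimeSpectrum.comap (funAlgEval s τ h t).toRingHom ⊥

theorem isOpen_ne_zero_of_mem_funAlg [TopologicalSpace T]
    (hτ : Continuous fun t => ev K (ptPow K V E (τ t))) {b : T → K} (hb : b ∈ funAlg s τ h) :
    IsOpen {t | b t ≠ 0} := by
  let O : (pow K V E).left.Opens :=
    ⟨⋂ e, ((powProj (V := V) e).left ⁻¹ᵁ s e : Set (pow K V E).left),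
      isOpen_iInter_of_finite fun e => ((powProj (V := V) e).left ⁻¹ᵁ s e).2⟩
  have hO : ∀ t, ev K (ptPow K V E (τ t)) ∈ O := by
    intro t
    refine Set.mem_iInter.mpr fun e => ?_
    have := h t e
    rw [← ptPow_comp_powProj (τ t) e] at this
    exact this
  have hle : funAlg s τ h ≤ (evalFun (fun t => ptPow K V E (τ t)) O hO).range := by
    refine iSup_le fun e => ?_
    rintro _ ⟨f, rfl⟩
    refine ⟨(powProj (V := V) e).left.appLE (s e) O (fun x hx => Set.mem_iInter.mp hx e) f, ?_⟩
    funext t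
    have h1 := evalAt_comp (ptPow K V E (τ t)) (powProj e) O (s e)
      (fun x hx => Set.mem_iInter.mp hx e) (hO t) (by rw [ptPow_comp_powProj]; exact h t e) f
    refine h1.symm.trans ?_
    change _ = evalAt (τ t e) (s e) (h t e) f
    congr 1
    simp only [ptPow_comp_powProj]
  obtain ⟨f, rfl⟩ := hle hb
  have : {t | evalFun (fun t => ptPow K V E (τ t)) O hO f t ≠ 0} =
      (fun t => ev K (ptPow K V E (τ t))) ⁻¹' ((pow K V E).left.basicOpen f) :=
    Set.ext fun t => evalAt_ne_zero_iff (ptPow K V E (τ t)) O (hO t) f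
  exact this ▸ ((pow K V E).left.basicOpen f).2.preimage hτ

theorem continuous_toPrimeSpectrum [TopologicalSpace T]
    (hτ : Continuous fun t => ev K (ptPow K V E (τ t))) : Continuous (toPrimeSpectrum s τ h) := by
  refine PrimeSpectrum.isTopologicalBasis_basic_opens.continuous_iff.mpr ?_
  rintro _ ⟨b, rfl⟩
  exact isOpen_ne_zero_of_mem_funAlg s τ h hτ b.2

theorem isInducing_toPrimeSpectrum [TopologicalSpace T] (hs : ∀ e, IsAffineOpen (s e))
    (hτ : IsInducing fun t => ev K (ptPow K V E (τ t))) : IsInducing (toPrimeSpectrum s τ h) := by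
  let φ (e : E) : Γ(V.left, s e) →ₐ[K] funAlg s τ h :=
    (evalFun (fun t => τ t e) (s e) fun t => h t e).codRestrict (funAlg s τ h) fun f =>
      le_iSup (fun e => (evalFun (fun t => τ t e) (s e) fun t => h t e).range) e ⟨f, rfl⟩
  let i : Over.mk (Spec.map (CommRingCat.ofHom (algebraMap K (funAlg s τ h)))) ⟶ pow K V E :=
    Pi.lift fun e => overSpecHom (hs e) (φ e)
  let y (t : T) : Pt K (Over.mk (Spec.map (CommRingCat.ofHom (algebraMap K (funAlg s τ h))))) :=
    Over.homMk (Spec.map (CommRingCat.ofHom (funAlgEval s τ h t).toRingHom)) (by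
      change Spec.map _ ≫ Spec.map _ = 𝟙 _
      rw [← Spec.map_comp, ← CommRingCat.ofHom_comp]
      have : (funAlgEval s τ h t).toRingHom.comp (algebraMap K (funAlg s τ h)) = RingHom.id K :=
        (funAlgEval s τ h t).comp_algebraMap
      rw [this]
      exact Spec.map_id _)
  have hyi (t : T) : y t ≫ i = ptPow K V E (τ t) := by
    refine Pi.hom_ext _ _ fun e => ?_
    refine (Category.assoc (y t) i (Pi.π _ e)).trans
      ((congrArg (y t ≫ ·) (Pi.lift_π _ e)).trans (Eq.trans ?_ (ptPow_comp_powProj (τ t) e).symm))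
    ext1
    refine Eq.trans ?_ (SpecMap_evalAt_fromSpec (hs e) (τ t e) (h t e))
    change Spec.map _ ≫ Spec.map _ ≫ _ = _
    rw [← Spec.map_comp_assoc]
    rfl
  have hcomp : (fun t => ev K (ptPow K V E (τ t))) = i.left.base ∘ toPrimeSpectrum s τ h :=
    funext fun t => by rw [← hyi t]; rfl
  exact IsInducing.of_comp (continuous_toPrimeSpectrum s τ h hτ.continuous)
    i.left.continuous (hcomp ▸ hτ)

end FunctionAlgebra

theorem subalgebra_fg_iSup {K J R : Type*} [Field K] [Finite J] [CommRing R] [Algebra K R]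
    (S : J → Subalgebra K R) (hS : ∀ j, (S j).FG) : (⨆ j, S j).FG := by
  have : Fintype J := Fintype.ofFinite J
  rw [← Finset.sup_univ_eq_iSup]
  exact Finset.sup_induction Subalgebra.fg_bot (fun _ h _ h' => h.sup h') fun j _ => hS j

theorem ringKrullDim_iSup_range_add_sum_le {K J R : Type*} [Field K] [Fintype J] [CommRing R]
    [Algebra K R] {S : J → Type*} [∀ j, CommRing (S j)] [∀ j, Algebra K (S j)]
    [∀ j, Algebra.FiniteType K (S j)] (f : ∀ j, S j →ₐ[K] R) (c m : J → ℕ)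
    (hdim : ∀ j, ringKrullDim (S j) + c j ≤ m j) :
    ringKrullDim ↥(⨆ j, (f j).range) + (∑ j, c j : ℕ) ≤ (∑ j, m j : ℕ) := by
  let g (j : J) : S j →ₐ[K] ↥(⨆ j, (f j).range) :=
    (f j).codRestrict _ fun x => le_iSup (fun j => (f j).range) j ⟨x, rfl⟩
  refine ringKrullDim_add_sum_le_of_iSup_range_eq_top g ?_ Finset.univ (fun j => Finset.mem_univ j)
    c m hdim
  refine Subalgebra.map_injective (f := (⨆ j, (f j).range).val) Subtype.val_injective ?_
  rw [(Subalgebra.gc_map_comap _).l_iSup, Algebra.map_top, Subalgebra.range_val]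
  refine iSup_congr fun j => ?_
  rw [← AlgHom.range_comp]
  rfl

section FunctionAlgebra

variable {K V} {E : Type} [Finite E] {T T' : Type}

/-- Precomposition of functions as a morphism of algebras. -/
def precomp (σ : T' → T) : (T → K) →ₐ[K] (T' → K) :=
  AlgHom.pi fun t => Pi.evalAlgHom K (fun _ : T => K) (σ t)

omit [Finite E] in
theorem map_precomp_funAlg (s : E → V.left.Opens) (τ : T → E → Pt K V)
    (h : ∀ t e, ev K (τ t e) ∈ s e) (σ : T' → T) :
    (funAlg s τ h).map (precomp σ) = funAlg s (τ ∘ σ) fun t => h (σ t) := by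
  rw [funAlg, (Subalgebra.gc_map_comap _).l_iSup, funAlg]
  refine iSup_congr fun e => ?_
  rw [← AlgHom.range_comp]
  rfl

omit [Finite E] in
theorem finiteType_section (hV : LocallyOfFiniteType V.hom) {U : V.left.Opens}
    (hU : IsAffineOpen U) : Algebra.FiniteType K Γ(V.left, U) := by
  have h1 : (Scheme.Hom.appLE (X := V.left) (Y := SpecK K) V.hom ⊤ U le_top).hom.FiniteType :=
    Scheme.Hom.finiteType_appLE V.hom (isAffineOpen_top _) hU le_top
  exact h1.comp (RingHom.FiniteType.of_surjective _
    (Scheme.ΓSpecIso (.of K)).symm.commRingCatIsoToRingEquiv.surjective)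

theorem fg_funAlg (hV : LocallyOfFiniteType V.hom) (s : E → V.left.Opens)
    (hs : ∀ e, IsAffineOpen (s e)) (τ : T → E → Pt K V) (h : ∀ t e, ev K (τ t e) ∈ s e) :
    (funAlg s τ h).FG := by
  refine subalgebra_fg_iSup _ fun e => ?_
  rw [← Algebra.map_top]
  exact (finiteType_section hV (hs e)).out.map _

theorem topologicalKrullDim_le_ringKrullDim_funAlg [TopologicalSpace T] (s : E → V.left.Opens)
    (hs : ∀ e, IsAffineOpen (s e)) (τ : T → E → Pt K V) (h : ∀ t e, ev K (τ t e) ∈ s e)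
    (hτ : IsInducing fun t => ev K (ptPow K V E (τ t))) :
    topologicalKrullDim T ≤ ringKrullDim (funAlg s τ h) := by
  rw [← PrimeSpectrum.topologicalKrullDim_eq_ringKrullDim]
  exact (isInducing_toPrimeSpectrum s τ h hs hτ).topologicalKrullDim_le

theorem ringKrullDim_funAlg_comp_succ_le [TopologicalSpace T] [PreirreducibleSpace T]
    (s : E → V.left.Opens) (hs : ∀ e, IsAffineOpen (s e)) (τ : T → E → Pt K V)
    (h : ∀ t e, ev K (τ t e) ∈ s e) (hτ : IsInducing fun t => ev K (ptPow K V E (τ t)))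
    (σ : T' → T) {Z : Set T} (hZ : IsClosed Z) (hσ : ∀ t, σ t ∈ Z) {t₀ : T} (ht₀ : t₀ ∉ Z) :
    ringKrullDim (funAlg s (τ ∘ σ) fun t => h (σ t)) + 1 ≤ ringKrullDim (funAlg s τ h) := by
  have hsurj : Function.Surjective ((precomp σ).comp (funAlg s τ h).val).rangeRestrict :=
    AlgHom.rangeRestrict_surjective _
  have hrange : ((precomp σ).comp (funAlg s τ h).val).range =
      funAlg s (τ ∘ σ) fun t => h (σ t) := by
    rw [AlgHom.range_comp, Subalgebra.range_val, map_precomp_funAlg]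
  rw [← hrange]
  have : NoZeroDivisors (funAlg s τ h) := ⟨fun {a b} hab => by
    by_contra! hcon
    have hopen (b : funAlg s τ h) : IsOpen {t | b.1 t ≠ 0} :=
      isOpen_ne_zero_of_mem_funAlg s τ h hτ.continuous b.2
    have hne (b : funAlg s τ h) (hb : b ≠ 0) : (Set.univ ∩ {t | b.1 t ≠ 0}).Nonempty := by
      by_contra hemp
      refine hb (Subtype.ext (funext fun t => ?_))
      by_contra ht
      exact hemp ⟨t, trivial, ht⟩
    obtain ⟨t, -, hta, htb⟩ := PreirreducibleSpace.isPreirreducible_univ _ _ (hopen a) (hopen b)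
      (hne a hcon.1) (hne b hcon.2)
    exact mul_ne_zero hta htb (congrFun (congrArg Subtype.val hab) t)⟩
  have : Nontrivial (funAlg s τ h) :=
    ⟨0, 1, fun h01 => zero_ne_one (congrFun (congrArg Subtype.val h01) t₀)⟩
  obtain ⟨Z', hZ', rfl⟩ := (isInducing_toPrimeSpectrum s τ h hs hτ).isClosed_iff.mp hZ
  obtain ⟨I, rfl⟩ := (PrimeSpectrum.isClosed_iff_zeroLocus _).mp hZ'
  obtain ⟨b, hbI, hb⟩ := Set.not_subset.mp ht₀
  refine ringKrullDim_succ_le_of_surjective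
    ((precomp σ).comp (funAlg s τ h).val).rangeRestrict.toRingHom hsurj (r := b)
    (mem_nonZeroDivisors_of_ne_zero ?_) ?_
  · rintro rfl
    exact hb (Submodule.zero_mem _)
  · refine Subtype.ext (funext fun t => ?_)
    exact hσ t hbI

end FunctionAlgebra

section Variety

variable {K V}

theorem ringKrullDim_section_le_vdim {U : V.left.Opens} (hU : IsAffineOpen U) :
    ringKrullDim Γ(V.left, U) ≤ vdim K V := by
  rw [← PrimeSpectrum.topologicalKrullDim_eq_ringKrullDim]
  exact hU.fromSpec.isOpenEmbedding.isInducing.topologicalKrullDim_le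

theorem exists_vdim_eq (hft : LocallyOfFiniteType V.hom) (hqc : QuasiCompact V.hom)
    (hne : Nonempty V.left) : ∃ n : ℕ, vdim K V = n := by
  have hcpt : CompactSpace V.left := by
    have : CompactSpace (SpecK K) := inferInstance
    exact QuasiCompact.compactSpace_of_compactSpace (Y := SpecK K) V.hom
  obtain ⟨S, hS, hcov⟩ := (isCompact_iff_finite_and_eq_biUnion_affineOpens (U := ⊤)).mp
    (isCompact_univ (X := V.left))
  have hdim (U : V.left.affineOpens) : ∃ n : ℕ, ringKrullDim Γ(V.left, U) ≤ n :=
    have := finiteType_section hft U.2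
    exists_ringKrullDim_le_of_finiteType K _
  choose d hd using hdim
  obtain ⟨N, hN⟩ := (hS.image d).bddAbove
  have hle : vdim K V ≤ N := by
    refine topologicalKrullDim_le_of_open_cover fun y => ?_
    have hy : y ∈ (⊤ : V.left.Opens) := trivial
    rw [hcov] at hy
    simp only [TopologicalSpace.Opens.mem_iSup] at hy
    obtain ⟨U, hUS, hyU⟩ := hy
    refine ⟨U.1, U.1.2, hyU, ?_⟩
    refine (U.2.isoSpec.hom.isOpenEmbedding.isInducing.topologicalKrullDim_le).trans ?_
    refine (PrimeSpectrum.topologicalKrullDim_eq_ringKrullDim _).trans_le ((hd U).trans ?_)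
    exact_mod_cast hN ⟨U, hUS, rfl⟩
  have hnonneg : 0 ≤ vdim K V :=
    have : Nonempty (TopologicalSpace.IrreducibleCloseds V.left) :=
      ⟨⟨closure {hne.some}, isIrreducible_singleton.closure, isClosed_closure⟩⟩
    Order.krullDim_nonneg
  revert hle hnonneg
  induction vdim K V using WithBot.recBotCoe with
  | bot => simp
  | coe d =>
    induction d using ENat.recTopCoe with
    | top =>
      intro hle
      exact absurd (WithBot.coe_le_coe.mp (show ((⊤ : ℕ∞) : WithBot ℕ∞) ≤ ((N : ℕ∞) : WithBot ℕ∞)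
        from hle)) (by simp)
    | coe k => exact fun _ _ => ⟨k, rfl⟩

theorem exists_ev_mem [IsAlgClosed K] (hft : LocallyOfFiniteType V.hom) {O : Set V.left}
    (hO : IsOpen O) (hne : O.Nonempty) : ∃ a : Pt K V, ev K a ∈ O := by
  have : JacobsonSpace V.left := LocallyOfFiniteType.jacobsonSpace (Y := SpecK K) V.hom
  obtain ⟨x, hxO, hx⟩ := (dense_iff_closure_eq.mpr
    (closure_closedPoints (X := V.left))).inter_open_nonempty O hO hne
  refine ⟨Over.homMk (pointOfClosedPoint (X := V.left) V.hom x hx)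
    (pointOfClosedPoint_comp (X := V.left) V.hom x hx), ?_⟩
  have : ev K (Over.homMk (pointOfClosedPoint (X := V.left) V.hom x hx)
    (pointOfClosedPoint_comp (X := V.left) V.hom x hx) : Pt K V) = x :=
      pointOfClosedPoint_apply (X := V.left) V.hom x hx _
  rwa [this]

theorem isPreirreducible_univ_cfg [IsAlgClosed K] (hft : LocallyOfFiniteType V.hom)
    (hirr : IrreducibleSpace V.left) (E : Type) [Finite E] :
    letI := cfgTop K V E
    IsPreirreducible (Set.univ : Set (E → Pt K V)) := by
  classical
  let _ := cfgTop K V E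
  let _ : TopologicalSpace (Pt K V) := .induced (ev K) inferInstance
  have : PreirreducibleSpace (Pt K V) := ⟨by
    rintro _ _ ⟨O, hO, rfl⟩ ⟨O', hO', rfl⟩ ⟨a, -, ha⟩ ⟨a', -, ha'⟩
    have hne := nonempty_preirreducible_inter hO hO' ⟨_, ha⟩ ⟨_, ha'⟩
    obtain ⟨b, hb⟩ := exists_ev_mem hft (hO.inter hO') hne
    exact ⟨b, trivial, hb⟩⟩
  refine isPreirreducible_univ_pi_of_continuous_update fun u e => ?_
  let g : V ⟶ pow K V E :=
    Pi.lift (Function.update (fun e' => Over.mkIdTerminal.from V ≫ u e') e (𝟙 V))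
  have hg (a : Pt K V) : a ≫ g = ptPow K V E (Function.update u e a) := by
    refine Pi.hom_ext _ _ fun e' => ?_
    refine (Category.assoc a g (Pi.π _ e')).trans
      ((congrArg (a ≫ ·) (Pi.lift_π _ e')).trans (Eq.trans ?_ (ptPow_comp_powProj _ e').symm))
    by_cases h : e' = e
    · subst h; simp
    · simp only [Function.update_of_ne h]
      rw [← Category.assoc, Over.mkIdTerminal.hom_ext (a ≫ Over.mkIdTerminal.from V) (𝟙 _),
        Category.id_comp]
  refine continuous_induced_rng.mpr ?_
  have : (fun u => ev K (ptPow K V E u)) ∘ (fun a => Function.update u e a) =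
      g.left.base ∘ ev K := funext fun a => by
    change ev K (ptPow K V E (Function.update u e a)) = _
    rw [← hg a]; rfl
  rw [this]
  exact g.left.continuous.comp continuous_induced_dom

end Variety

section Dimension

variable {K V}

theorem add_natCast_le_natCast_iff (x : WithBot ℕ∞) (C M : ℕ) :
    x + C ≤ M ↔ x ≤ if C ≤ M then ((M - C : ℕ) : WithBot ℕ∞) else ⊥ := by
  induction x using WithBot.recBotCoe with
  | bot => simp
  | coe d =>
    induction d using ENat.recTopCoe with
    | top =>
      refine iff_of_false (fun h => ?_) fun h => ?_
      · have h' : (⊤ : ℕ∞) + (C : ℕ∞) ≤ (M : ℕ∞) := WithBot.coe_le_coe.mp h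
        simp at h'
      · split_ifs at h
        · have h' : (⊤ : ℕ∞) ≤ ((M - C : ℕ) : ℕ∞) := WithBot.coe_le_coe.mp h
          simp at h'
        · simp at h
    | coe k =>
      have h1 : (((k : ℕ∞) : WithBot ℕ∞) + C ≤ M) ↔ k + C ≤ M := by norm_cast
      rw [h1]
      split_ifs with h
      · have h2 : (((k : ℕ∞) : WithBot ℕ∞) ≤ ((M - C : ℕ) : WithBot ℕ∞)) ↔ k ≤ M - C :=
          Nat.cast_le (α := WithBot ℕ∞)
        rw [h2]
        omega
      · simp only [le_bot_iff, WithBot.coe_ne_bot, iff_false]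
        omega

theorem isOpen_cfg_pi {E : Type} [Finite E] (s : E → V.left.Opens) :
    letI := cfgTop K V E
    IsOpen {u : E → Pt K V | ∀ e, ev K (u e) ∈ s e} := by
  refine ⟨⋂ e, ((powProj (V := V) e).left ⁻¹ᵁ s e : Set (pow K V E).left),
    isOpen_iInter_of_finite fun e => ((powProj (V := V) e).left ⁻¹ᵁ s e).2, ?_⟩
  ext u
  simp only [Set.mem_preimage, Set.mem_iInter]
  refine forall_congr' fun e => ?_
  conv_rhs => rw [← ptPow_comp_powProj u e]
  rfl

theorem ringKrullDim_funAlg_le (hft : LocallyOfFiniteType V.hom) {n : ℕ} (hn : vdim K V = n)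
    {E T : Type} [Fintype E] (s : E → V.left.Opens) (hs : ∀ e, IsAffineOpen (s e))
    (τ : T → E → Pt K V) (h : ∀ t e, ev K (τ t e) ∈ s e) :
    ringKrullDim (funAlg s τ h) ≤ (n * Fintype.card E : ℕ) := by
  have (e : E) := finiteType_section hft (hs e)
  have key : ringKrullDim (funAlg s τ h) + (∑ _ : E, 0 : ℕ) ≤ (∑ _ : E, n : ℕ) :=
    ringKrullDim_iSup_range_add_sum_le
      (fun e => evalFun (fun t => τ t e) (s e) fun t => h t e) (fun _ => 0) (fun _ => n)
      fun e => by simpa [hn] using ringKrullDim_section_le_vdim (hs e)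
  rwa [Finset.sum_const_zero, Nat.cast_zero, add_zero, Finset.sum_const, Finset.card_univ,
    smul_eq_mul, mul_comm] at key

theorem ringKrullDim_funAlg_succ_le [IsAlgClosed K] (hft : LocallyOfFiniteType V.hom)
    (hirr : IrreducibleSpace V.left) {n : ℕ} (hn : vdim K V = n)
    {E : Type} [Fintype E] (s : E → V.left.Opens) (hs : ∀ e, IsAffineOpen (s e))
    {D : Set (E → Pt K V)} (hD : cfgClosed K V E D) (hD' : D ≠ Set.univ) :
    ringKrullDim (funAlg s (fun u : {u : E → Pt K V // u ∈ D ∧ ∀ e, ev K (u e) ∈ s e} => u.1)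
      fun u => u.2.2) + 1 ≤ (n * Fintype.card E : ℕ) := by
  let _ := cfgTop K V E
  let O : Set (E → Pt K V) := {u | ∀ e, ev K (u e) ∈ s e}
  have hO : IsOpen O := isOpen_cfg_pi s
  have hpre := isPreirreducible_univ_cfg hft hirr E
  by_cases hne : O.Nonempty
  · obtain ⟨v, hv⟩ := (Set.ne_univ_iff_exists_notMem D).mp hD'
    obtain ⟨w, hw⟩ := hne
    obtain ⟨t₀, -, ht₀O, ht₀D⟩ := hpre O Dᶜ hO (IsClosed.isOpen_compl (self := hD))
      ⟨w, trivial, hw⟩ ⟨v, trivial, hv⟩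
    have : PreirreducibleSpace O :=
      Subtype.preirreducibleSpace (hpre.open_subset hO (Set.subset_univ _))
    have hind : IsInducing fun t : O => ev K (ptPow K V E t.1) :=
      (IsInducing.induced fun u => ev K (ptPow K V E u)).comp IsInducing.subtypeVal
    refine (ringKrullDim_funAlg_comp_succ_le s hs (fun t : O => t.1) (fun t => t.2) hind
      (fun u : {u : E → Pt K V // u ∈ D ∧ ∀ e, ev K (u e) ∈ s e} => ⟨u.1, u.2.2⟩)
      (Z := Subtype.val ⁻¹' D) (hD.preimage continuous_subtype_val) (fun u => u.2.1)
      (t₀ := ⟨t₀, ht₀O⟩) ht₀D).trans (ringKrullDim_funAlg_le hft hn s hs _ _)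
  · have : IsEmpty {u : E → Pt K V // u ∈ D ∧ ∀ e, ev K (u e) ∈ s e} :=
      ⟨fun u => hne ⟨u.1, u.2.2⟩⟩
    rw [ringKrullDim_eq_bot_of_subsingleton]
    simp

omit [Group G] in
theorem ringKrullDim_funAlg_add_sum_le [IsAlgClosed K] (hft : LocallyOfFiniteType V.hom)
    (hirr : IrreducibleSpace V.left) {n : ℕ} (hn : vdim K V = n)
    {Γ : Set (G → Pt K V)} (hΓ : ∀ Ω : Finset G, cfgClosed K V ↥Ω (restr K V Γ Ω))
    {J : Type} [Fintype J] (F : Finset G) (E : J → Finset G) (hEF : ∀ j, E j ⊆ F)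
    (hcov : ∀ g ∈ F, ∃ j, g ∈ E j) (c : J → ℕ)
    (hc : ∀ j, c j = 0 ∨ c j = 1 ∧ restr K V Γ (E j) ≠ Set.univ)
    {T : Type} (s : ↥F → V.left.Opens) (hs : ∀ e, IsAffineOpen (s e))
    (τ : T → ↥F → Pt K V) (h : ∀ t e, ev K (τ t e) ∈ s e) (hτ : ∀ t, τ t ∈ restr K V Γ F) :
    ringKrullDim (funAlg s τ h) + (∑ j, c j : ℕ) ≤ (∑ j, n * (E j).card : ℕ) := by
  let i (j : J) (e : ↥(E j)) : ↥F := ⟨e.1, hEF j e.2⟩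
  let P (j : J) : Type := {u : ↥(E j) → Pt K V // u ∈ restr K V Γ (E j) ∧ ∀ e, ev K (u e) ∈ s (i j e)}
  let B (j : J) : Subalgebra K (P j → K) := funAlg (fun e => s (i j e)) (fun u => u.1) fun u => u.2.2
  let σ (j : J) (t : T) : P j := ⟨fun e => τ t (i j e), by
    obtain ⟨x, hx, hxt⟩ := hτ t
    exact ⟨x, hx, by rw [← hxt]⟩, fun e => h t (i j e)⟩
  have (j : J) : Algebra.FiniteType K (B j) :=
    (Subalgebra.fg_iff_finiteType _).mp (fg_funAlg hft _ (fun e => hs (i j e)) _ _)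
  have hdim (j : J) : ringKrullDim (B j) + c j ≤ (n * (E j).card : ℕ) := by
    rcases hc j with h0 | ⟨h1, hne⟩
    · rw [h0, Nat.cast_zero, add_zero]
      simpa using ringKrullDim_funAlg_le hft hn _ (fun e => hs (i j e)) (fun u : P j => u.1)
        fun u => u.2.2
    · rw [h1, Nat.cast_one]
      simpa using ringKrullDim_funAlg_succ_le hft hirr hn _ (fun e => hs (i j e)) (hΓ (E j)) hne
  have key := ringKrullDim_iSup_range_add_sum_le (fun j => (precomp (σ j)).comp (B j).val) c _ hdim
  have heq : ⨆ j, ((precomp (σ j)).comp (B j).val).range = funAlg s τ h := by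
    have h1 (j : J) : ((precomp (σ j)).comp (B j).val).range =
        ⨆ e, (evalFun (fun t => τ t (i j e)) (s (i j e)) fun t => h t (i j e)).range := by
      rw [AlgHom.range_comp, Subalgebra.range_val, map_precomp_funAlg]
      rfl
    simp_rw [h1]
    refine le_antisymm (iSup₂_le fun j e => le_iSup
      (fun e => (evalFun (fun t => τ t e) (s e) fun t => h t e).range) (i j e))
      (iSup_le fun e => ?_)
    obtain ⟨j, hj⟩ := hcov e.1 e.2
    exact le_iSup₂ (f := fun j (e : ↥(E j)) =>
      (evalFun (fun t => τ t (i j e)) (s (i j e)) fun t => h t (i j e)).range) j ⟨e.1, hj⟩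
  rwa [heq] at key

omit [Group G] in
theorem cfgDim_restr_add_sum_le [IsAlgClosed K] (hft : LocallyOfFiniteType V.hom)
    (hirr : IrreducibleSpace V.left) {n : ℕ} (hn : vdim K V = n)
    {Γ : Set (G → Pt K V)} (hΓ : ∀ Ω : Finset G, cfgClosed K V ↥Ω (restr K V Γ Ω))
    {J : Type} [Fintype J] (F : Finset G) (E : J → Finset G) (hEF : ∀ j, E j ⊆ F)
    (hcov : ∀ g ∈ F, ∃ j, g ∈ E j) (c : J → ℕ)
    (hc : ∀ j, c j = 0 ∨ c j = 1 ∧ restr K V Γ (E j) ≠ Set.univ) :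
    cfgDim K V ↥F (restr K V Γ F) + (∑ j, c j : ℕ) ≤ (∑ j, n * (E j).card : ℕ) := by
  let _ := cfgTop K V ↥F
  rw [add_natCast_le_natCast_iff]
  refine topologicalKrullDim_le_of_open_cover fun y => ?_
  choose s hs hys using fun e => exists_isAffineOpen_mem_and_subset
    (TopologicalSpace.Opens.mem_top (ev K (y.1 e)))
  refine ⟨Subtype.val ⁻¹' {u | ∀ e, ev K (u e) ∈ s e},
    (isOpen_cfg_pi s).preimage continuous_subtype_val, fun e => (hys e).1, ?_⟩
  rw [← add_natCast_le_natCast_iff]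
  have hind : IsInducing fun t : (Subtype.val ⁻¹' {u | ∀ e, ev K (u e) ∈ s e} :
      Set (restr K V Γ F)) => ev K (ptPow K V ↥F t.1.1) :=
    (IsInducing.induced fun u => ev K (ptPow K V ↥F u)).comp
      (IsInducing.subtypeVal.comp IsInducing.subtypeVal)
  exact (add_le_add_left (topologicalKrullDim_le_ringKrullDim_funAlg s hs
    (fun t => t.1.1) (fun t => t.2) hind) _).trans
    (ringKrullDim_funAlg_add_sum_le hft hirr hn hΓ F E hEF hcov c hc s hs _ _ fun t => t.1.2)

end Dimension

section Restriction

variable {K V}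

theorem restr_image_mul_left_ne_univ [DecidableEq G] {Γ : Set (G → Pt K V)}
    (hinv : ShiftInvariant Γ) {Ω : Finset G} (hΩ : restr K V Γ Ω ≠ Set.univ) (g : G) :
    restr K V Γ (Ω.image (g * ·)) ≠ Set.univ := by
  contrapose! hΩ
  refine Set.eq_univ_of_forall fun u => ?_
  have : (fun x : ↥(Ω.image (g * ·)) => u ⟨g⁻¹ * x.1, by
      obtain ⟨y, hy, hyx⟩ := Finset.mem_image.mp x.2
      rw [← hyx]; simpa using hy⟩) ∈ restr K V Γ (Ω.image (g * ·)) := hΩ ▸ Set.mem_univ _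
  obtain ⟨c, hc, hcu⟩ := this
  refine ⟨_, hinv g⁻¹ c hc, funext fun ω => ?_⟩
  have := congrFun hcu ⟨g * ω.1, Finset.mem_image_of_mem _ ω.2⟩
  simpa using this

theorem exists_restr_ne_univ [DecidableEq G] {Γ : Set (G → Pt K V)}
    (hΓ : ProdiscreteClosed Γ) (hne : Γ ≠ Set.univ) :
    ∃ Ω : Finset G, 1 ∈ Ω ∧ restr K V Γ Ω ≠ Set.univ := by
  let _ : TopologicalSpace (Pt K V) := ⊥
  have : DiscreteTopology (Pt K V) := ⟨rfl⟩
  obtain ⟨c, hc⟩ := (Set.ne_univ_iff_exists_notMem Γ).mp hne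
  obtain ⟨I, u, hu, hsub⟩ := isOpen_pi_iff.mp (IsClosed.isOpen_compl (self := hΓ)) c hc
  refine ⟨insert 1 I, Finset.mem_insert_self _ _, fun h => ?_⟩
  have : (fun ω : ↥(insert 1 I) => c ω) ∈ restr K V Γ (insert 1 I) := h ▸ Set.mem_univ _
  obtain ⟨x, hx, hxc⟩ := this
  refine hsub (fun g hg => ?_) hx
  have := congrFun hxc ⟨g, Finset.mem_insert_of_mem hg⟩
  simp only at this
  rw [this]
  exact (hu g hg).2

omit [Group G] in
theorem cfgDim_restr_add_card_le [DecidableEq G] [IsAlgClosed K]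
    (hft : LocallyOfFiniteType V.hom)
    (hirr : IrreducibleSpace V.left) {n : ℕ} (hn : vdim K V = n)
    {Γ : Set (G → Pt K V)} (hΓ : ∀ Ω : Finset G, cfgClosed K V ↥Ω (restr K V Γ Ω))
    (F T : Finset G) (E : G → Finset G) (hEF : ∀ g ∈ T, E g ⊆ F)
    (hdisj : (T : Set G).PairwiseDisjoint E) (hE : ∀ g ∈ T, restr K V Γ (E g) ≠ Set.univ) :
    cfgDim K V ↥F (restr K V Γ F) + T.card ≤ (n * F.card : ℕ) := by
  let R := F \ T.biUnion E
  let E' : ↥T ⊕ ↥R → Finset G := Sum.elim (fun g => E g.1) fun g => {g.1}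
  have key := cfgDim_restr_add_sum_le hft hirr hn hΓ F E'
    (by
      rintro (g | g)
      · exact hEF g.1 g.2
      · exact Finset.singleton_subset_iff.mpr (Finset.mem_sdiff.mp g.2).1)
    (fun g hg => by
      by_cases h : g ∈ T.biUnion E
      · obtain ⟨t, ht, hgt⟩ := Finset.mem_biUnion.mp h
        exact ⟨.inl ⟨t, ht⟩, hgt⟩
      · exact ⟨.inr ⟨g, Finset.mem_sdiff.mpr ⟨hg, h⟩⟩, Finset.mem_singleton_self g⟩)
    (Sum.elim (fun _ => 1) fun _ => 0)
    (by
      rintro (g | g)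
      · exact .inr ⟨rfl, hE g.1 g.2⟩
      · exact .inl rfl)
  have hsub : T.biUnion E ⊆ F := Finset.biUnion_subset.mpr hEF
  have hcard : ∑ j, n * (E' j).card = n * F.card := by
    rw [← Finset.mul_sum, Fintype.sum_sum_type]
    congr 1
    simp only [E', Sum.elim_inl, Sum.elim_inr, Finset.card_singleton, Finset.sum_const,
      Finset.card_univ, Fintype.card_coe, smul_eq_mul, mul_one]
    rw [Finset.sum_coe_sort T fun g => (E g).card, ← Finset.card_biUnion hdisj, add_comm]
    exact Finset.card_sdiff_add_card_eq_card hsub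
  rw [hcard] at key
  simpa using key

end Restriction

/-- Lemma 5.3. Let `G` be an amenable group with a Følner net `𝓕`,
`X` an irreducible algebraic variety over an algebraically closed field `K`, and
`A := X(K)`. If a `G`-invariant subset `Γ ⊆ A^G` is closed in the prodiscrete topology,
has all restrictions `Γ_Ω` Zariski-closed, and has maximal algebraic mean dimension
`mdim_𝓕(Γ) = dim X`, then `Γ = A^G`. -/
theorem eq_univ_of_maximal_mdim
    (G : Type) [Group G] (𝓕 : FolnerNet G)
    (K : Type) [Field K] [IsAlgClosed K]
    (V : Over (SpecK K)) (hft : LocallyOfFiniteType V.hom) (hqc : QuasiCompact V.hom)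
    (hirr : IrreducibleSpace V.left)
    (Γ : Set (G → Pt K V)) (hinv : ShiftInvariant Γ)
    (hD1 : ProdiscreteClosed Γ)
    (hD2 : ∀ Ω : Finset G, cfgClosed K V ↥Ω (restr K V Γ Ω))
    (hD3 : mdim K V 𝓕 Γ = dimE (vdim K V)) :
    Γ = Set.univ := by
  classical
  by_contra hne
  obtain ⟨n, hn⟩ := exists_vdim_eq hft hqc inferInstance
  obtain ⟨Ω, hΩ1, hΩ⟩ := exists_restr_ne_univ hD1 hne
  obtain ⟨c, hc, hT⟩ := 𝓕.exists_disjoint_translates Ω hΩ1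
  have hle : mdim K V 𝓕 Γ ≤ ((n - c : ℝ) : EReal) := by
    refine limsup_le_of_le ?_ (hT.mono ?_)
    · isBoundedDefault
    rintro i ⟨T, hTF, hdisj, hcard⟩
    exact dimE_mul_inv_le (Finset.card_pos.mpr (𝓕.nonempty i))
      (cfgDim_restr_add_card_le hft hirr hn hD2 (𝓕.F i) T (fun g => Ω.image (g * ·)) hTF hdisj
        fun g _ => restr_image_mul_left_ne_univ hinv hΩ g) hcard
  have hdim : dimE (n : WithBot ℕ∞) = ((n : ℝ) : EReal) := dimE_natCast n
  rw [hD3, hn, hdim, EReal.coe_le_coe_iff] at hle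
  linarith

end GOE
end
end

section
/- Let G be a group, let X be an algebraic variety over an algebraically closed field K, let A := X(K), and let τ : A^G → A^G be an algebraic cellular automaton over (G,X,K). Then: (i) if X is irreducible and τ is (**)-pre-injective, then τ is (*)-pre-injective; (ii) if X is irreducible and complete over K, then τ is (*)-pre-injective if and only if τ is (**)-pre-injective. -/
open AlgebraicGeometry CategoryTheory CategoryTheory.Limits Filter Topology
open scoped ENNReal NNReal

theorem Algebra.trdeg_quotient_add_one_le {K B : Type} [Field K] [CommRing B] [IsDomain B]
    [Algebra K B] (q : Ideal B) [q.IsPrime] (hq : q ≠ ⊥) :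
    Algebra.trdeg K (B ⧸ q) + 1 ≤ Algebra.trdeg K B := by
  have : FaithfulSMul K (B ⧸ q) :=
    (faithfulSMul_iff_algebraMap_injective _ _).2 (algebraMap K (B ⧸ q)).injective
  obtain ⟨s, hs⟩ := exists_isTranscendenceBasis K (B ⧸ q)
  obtain ⟨b, hbq, hb0⟩ := Submodule.exists_mem_ne_zero_of_ne_bot hq
  let π : B →ₐ[K] B ⧸ q := Ideal.Quotient.mkₐ K q
  have hπ : Function.Surjective π := Ideal.Quotient.mkₐ_surjective K q
  let x : s → B := fun i => (hπ i).choose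
  have hx : ∀ i, π (x i) = i := fun i => (hπ i).choose_spec
  have hcomp : (π ∘ x) = ((↑) : s → B ⧸ q) := funext hx
  have hxi : AlgebraicIndependent K x := by
    refine AlgebraicIndependent.of_comp π ?_
    rw [hcomp]; exact hs.1
  have htr : Transcendental (Algebra.adjoin K (Set.range x)) b := by
    intro halg
    obtain ⟨P, hP0, hP⟩ :=
      halg.exists_nonzero_coeff_and_aeval_eq_zero (mem_nonZeroDivisors_of_ne_zero hb0)
    apply hP0
    have hmem : ((P.coeff 0 : Algebra.adjoin K (Set.range x)) : B) ∈ q := by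
      rw [← Polynomial.divX_mul_X_add P] at hP
      simp only [map_add, map_mul, Polynomial.aeval_X, Polynomial.aeval_C] at hP
      have : algebraMap (Algebra.adjoin K (Set.range x)) B (P.coeff 0) =
        - (Polynomial.aeval b P.divX * b) := by linear_combination hP
      change algebraMap (Algebra.adjoin K (Set.range x)) B (P.coeff 0) ∈ q
      rw [this]
      exact q.neg_mem (q.mul_mem_left _ hbq)
    obtain ⟨Q, hQ⟩ : ∃ Q, MvPolynomial.aeval x Q = ((P.coeff 0 : _) : B) :=
      AlgHom.mem_range _ |>.1 ((Algebra.adjoin_range_eq_range_aeval K x).le (P.coeff 0).2)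
    have h2 : MvPolynomial.aeval ((↑) : s → B ⧸ q) Q = 0 := by
      rw [← hcomp]
      have : MvPolynomial.aeval (π ∘ x) Q = π (MvPolynomial.aeval x Q) := by
        exact (MvPolynomial.comp_aeval_apply (f := x) π Q).symm
      rw [this, hQ]
      exact Ideal.Quotient.eq_zero_iff_mem.2 hmem
    have h3 : Q = 0 := (injective_iff_map_eq_zero _).1 hs.1 Q h2
    ext
    rw [← hQ, h3]; simp
  have := (hxi.option_iff_transcendental b).2 htr
  have h2 := this.cardinalMk_le_trdeg
  rwa [Cardinal.mk_option, hs.cardinalMk_eq_trdeg] at h2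

theorem ringKrullDim_le_of_isIntegral_of_injective {R S : Type*} [CommRing R] [CommRing S]
    [Algebra R S] [Algebra.IsIntegral R S] [FaithfulSMul R S] :
    ringKrullDim R ≤ ringKrullDim S := by
  refine iSup_le fun l => ?_
  obtain ⟨P, hP, hP'⟩ := (inferInstance : Nonempty ((RelSeries.head l).asIdeal.primesOver S))
  obtain ⟨L, hL, -⟩ := Ideal.exists_ltSeries_of_hasGoingUp l P (lo := hP')
  rw [← hL]
  exact le_iSup (fun p : LTSeries (PrimeSpectrum S) => (p.length : WithBot ℕ∞)) L

theorem toENat_trdeg_le_ringKrullDim {K B : Type} [Field K] [CommRing B] [IsDomain B]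
    [Algebra K B] [Algebra.FiniteType K B] :
    (Cardinal.toENat (Algebra.trdeg K B) : WithBot ℕ∞) ≤ ringKrullDim B := by
  obtain ⟨s, g, hg, hint⟩ := exists_integral_inj_algHom_of_fg K B
  algebraize [g.toRingHom]
  have : FaithfulSMul (MvPolynomial (Fin s) K) B :=
    (faithfulSMul_iff_algebraMap_injective _ _).2 hg
  have : IsScalarTower K (MvPolynomial (Fin s) K) B :=
    .of_algebraMap_eq fun x => (g.commutes x).symm
  have h1 := trdeg_add_eq K (MvPolynomial (Fin s) K) (A := B)
  rw [trdeg_eq_zero (R := MvPolynomial (Fin s) K), MvPolynomial.trdeg_of_isDomain] at h1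
  have := ringKrullDim_le_of_isIntegral_of_injective (R := MvPolynomial (Fin s) K) (S := B)
  rw [← h1]
  simpa using this

/-- The transcendence degree of a `K`-algebra given by its structure map. -/
noncomputable def RingHom.trdegENat {K L : Type} [CommRing K] [CommRing L] (φ : K →+* L) :
    ℕ∞ :=
  letI := φ.toAlgebra
  Cardinal.toENat (Algebra.trdeg K L)

theorem RingHom.trdegENat_le_comp {K L M : Type} [CommRing K] [CommRing L] [CommRing M]
    (φ : K →+* L) (ψ : L →+* M) (hψ : Function.Injective ψ) :
    φ.trdegENat ≤ (ψ.comp φ).trdegENat := by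
  algebraize [φ, ψ, ψ.comp φ]
  exact OrderHomClass.mono Cardinal.toENat
    (trdeg_le_of_injective (IsScalarTower.toAlgHom K L M) hψ)

theorem RingHom.trdegENat_comp_of_isIntegral {K L M : Type} [Field K] [CommRing L] [CommRing M]
    [IsDomain M] (φ : K →+* L) (ψ : L →+* M) (hψ : Function.Injective ψ)
    (h : ∀ y : M, ∃ a : L, a ≠ 0 ∧ ψ.IsIntegralElem (ψ a * y)) :
    (ψ.comp φ).trdegENat = φ.trdegENat := by
  algebraize [φ, ψ, ψ.comp φ]
  have : IsDomain L := hψ.isDomain ψ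
  have : FaithfulSMul L M := (faithfulSMul_iff_algebraMap_injective _ _).2 hψ
  have : FaithfulSMul K L :=
    (faithfulSMul_iff_algebraMap_injective _ _).2 (algebraMap K L).injective
  have : Algebra.IsAlgebraic L M := ⟨fun y => by
    obtain ⟨a, ha, hy⟩ := h y
    exact IsAlgebraic.iff_exists_smul_integral.2 ⟨a, ha, by rw [Algebra.smul_def]; exact hy⟩⟩
  have h1 := trdeg_add_eq K L (A := M)
  rw [trdeg_eq_zero (R := L), add_zero] at h1
  exact congrArg _ h1.symm

theorem RingHom.trdegENat_quotient_add_one_le {K A : Type} [Field K] [CommRing A] (φ : K →+* A)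
    (p q : Ideal A) [p.IsPrime] [q.IsPrime] (h : p < q) :
    ((Ideal.Quotient.mk q).comp φ).trdegENat + 1 ≤ ((Ideal.Quotient.mk p).comp φ).trdegENat := by
  algebraize [φ]
  let q' := q.map (Ideal.Quotient.mkₐ K p)
  let e : ((A ⧸ p) ⧸ q') ≃ₐ[K] A ⧸ q := DoubleQuot.quotQuotEquivQuotOfLEₐ K h.le
  have hq' : q'.IsPrime := by
    refine Ideal.map_isPrime_of_surjective (Ideal.Quotient.mkₐ_surjective K p) ?_
    exact (Ideal.Quotient.mkₐ_ker K p).trans_le h.le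
  have h0 : q' ≠ ⊥ := by
    intro h0
    obtain ⟨x, hxq, hxp⟩ := SetLike.exists_of_lt h
    have := Ideal.mem_map_of_mem (Ideal.Quotient.mkₐ K p) hxq
    rw [show q.map (Ideal.Quotient.mkₐ K p) = ⊥ from h0, Ideal.mem_bot] at this
    exact hxp (Ideal.Quotient.eq_zero_iff_mem.1 this)
  have h1 := Algebra.trdeg_quotient_add_one_le (K := K) q' h0
  have h2 := trdeg_le_of_injective e.symm.toAlgHom e.symm.injective
  have h3 := OrderHomClass.mono Cardinal.toENat ((add_le_add_left h2 1).trans h1)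
  rw [map_add, map_one] at h3
  exact h3

theorem Order.krullDim_le_of_add_one_le {α : Type*} [Preorder α] (g : α → ℕ∞) (N : ℕ∞)
    (hg : ∀ a b, a < b → g a + 1 ≤ g b) (hN : ∀ a, g a ≤ N) : Order.krullDim α ≤ N := by
  refine iSup_le fun l => ?_
  have key : ∀ (n : ℕ) (h : n < l.length + 1), (n : ℕ∞) ≤ g (l.toFun ⟨n, h⟩) := by
    intro n
    induction n with
    | zero => intro; simp
    | succ n ih =>
      intro h
      push_cast
      exact (add_le_add_left (ih (by omega)) 1).trans (hg _ _ (l.step ⟨n, by omega⟩))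
  exact WithBot.coe_le_coe.2 ((key l.length (by omega)).trans (hN _))

theorem Topology.IsInducing.isIrreducible_preimage {X Y : Type*} [TopologicalSpace X]
    [TopologicalSpace Y] {f : X → Y} (hf : IsInducing f) {s : Set Y}
    (h : IsIrreducible (s ∩ Set.range f)) : IsIrreducible (f ⁻¹' s) := by
  refine ⟨?_, ?_⟩
  · obtain ⟨_, hs, x, rfl⟩ := h.1
    exact ⟨x, hs⟩
  · rintro u v hu hv ⟨x, hxs, hxu⟩ ⟨y, hys, hyv⟩
    obtain ⟨u, hu', rfl⟩ := hf.isOpen_iff.1 hu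
    obtain ⟨v, hv', rfl⟩ := hf.isOpen_iff.1 hv
    obtain ⟨_, ⟨hz, z, rfl⟩, hzu, hzv⟩ :=
      h.2 u v hu' hv' ⟨f x, ⟨hxs, x, rfl⟩, hxu⟩ ⟨f y, ⟨hys, y, rfl⟩, hyv⟩
    exact ⟨z, hz, hzu, hzv⟩

namespace AlgebraicGeometry.Scheme
open TopologicalSpace

/-- The transcendence degree over `K` of the residue field of a point of a `K`-scheme. -/
noncomputable def ptDim {K : Type} [Field K] {S : Scheme.{0}} (s : S ⟶ Spec (.of K)) (y : S) :
    ℕ∞ :=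
  (Spec.preimage (S.fromSpecResidueField y ≫ s)).hom.trdegENat

section
variable {K : Type} [Field K] {S T : Scheme.{0}} (s : S ⟶ Spec (.of K)) (f : T ⟶ S)

theorem preimage_fromSpecResidueField_comp (x : T) :
    (Spec.preimage (T.fromSpecResidueField x ≫ f ≫ s)) =
    (Spec.preimage (S.fromSpecResidueField (f x) ≫ s)) ≫ f.residueFieldMap x := by
  apply Spec.map_injective
  simp [Scheme.Hom.SpecMap_residueFieldMap_fromSpecResidueField_assoc]

theorem ptDim_apply_le (x : T) : ptDim s (f x) ≤ ptDim (f ≫ s) x := by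
  unfold ptDim
  rw [preimage_fromSpecResidueField_comp]
  exact RingHom.trdegENat_le_comp _ _ (f.residueFieldMap x).hom.injective

theorem ptDim_apply_of_isOpenImmersion [IsOpenImmersion f] (x : T) :
    ptDim (f ≫ s) x = ptDim s (f x) := by
  unfold ptDim
  rw [preimage_fromSpecResidueField_comp]
  refine RingHom.trdegENat_comp_of_isIntegral _ _ (f.residueFieldMap x).hom.injective ?_
  intro y
  refine ⟨1, one_ne_zero, ?_⟩
  have := (ConcreteCategory.isIso_iff_bijective (f.residueFieldMap x)).1 inferInstance
  obtain ⟨z, hz⟩ := this.2 y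
  rw [map_one, one_mul, ← hz]
  exact RingHom.isIntegralElem_map _

theorem ptDim_Spec {A : CommRingCat.{0}} (φ : CommRingCat.of K ⟶ A) (p : Spec A) :
    ptDim (Spec.map φ) p = ((Ideal.Quotient.mk p.asIdeal).comp φ.hom).trdegENat := by
  have hp : p.asIdeal.IsPrime := PrimeSpectrum.isPrime p
  have h1 : Spec.preimage ((Spec A).fromSpecResidueField p ≫ Spec.map φ) =
      φ ≫ CommRingCat.ofHom (algebraMap A p.asIdeal.ResidueField) ≫
        (Spec.residueFieldIso A p).inv := by
    apply Spec.map_injective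
    rw [Spec.map_preimage, Spec.map_comp, Spec.map_comp,
      Spec.map_residueFieldIso_inv_eq_fromSpecResidueField]
  let ψ : A ⧸ p.asIdeal →+* (Spec A).residueField p :=
    (Spec.residueFieldIso A p).inv.hom.comp (algebraMap (A ⧸ p.asIdeal) p.asIdeal.ResidueField)
  have hiso := (ConcreteCategory.isIso_iff_bijective (Spec.residueFieldIso A p).inv).1 inferInstance
  have hψ : Function.Injective ψ :=
    hiso.1.comp (IsFractionRing.injective (A ⧸ p.asIdeal) p.asIdeal.ResidueField)
  have h2 := RingHom.trdegENat_comp_of_isIntegral ((Ideal.Quotient.mk p.asIdeal).comp φ.hom) ψ hψ ?_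
  · rw [← h2, ptDim, h1]
    rfl
  · intro y
    obtain ⟨z, rfl⟩ := hiso.2 y
    obtain ⟨a, b, hb, rfl⟩ := IsFractionRing.div_surjective (A := A ⧸ p.asIdeal) z
    have hb0 := nonZeroDivisors.ne_zero hb
    refine ⟨b, hb0, ?_⟩
    have : ψ b * (Spec.residueFieldIso A p).inv.hom (algebraMap _ _ a / algebraMap _ _ b) =
        ψ a := by
      rw [RingHom.comp_apply, ← map_mul, mul_div_cancel₀]
      · rfl
      · simpa using hb0
    exact this ▸ RingHom.isIntegralElem_map _

end

section
variable {K : Type} [Field K] {S T : Scheme.{0}} (s : S ⟶ Spec (.of K))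

theorem exists_affine_chart (y : S) :
    ∃ (A : CommRingCat.{0}) (j : Spec A ⟶ S) (_ : IsOpenImmersion j) (p : Spec A)
      (φ : CommRingCat.of K ⟶ A), j p = y ∧ j ≫ s = Spec.map φ := by
  obtain ⟨U, hU, hy, -⟩ := exists_isAffineOpen_mem_and_subset (X := S) (U := ⊤) (x := y) trivial
  obtain ⟨p, hp⟩ := hU.range_fromSpec.ge hy
  exact ⟨_, hU.fromSpec, inferInstance, p, Spec.preimage (hU.fromSpec ≫ s), hp,
    (Spec.map_preimage _).symm⟩

theorem ptDim_add_one_le_of_specializes {y z : S} (h : y ⤳ z) (hne : y ≠ z) :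
    ptDim s z + 1 ≤ ptDim s y := by
  obtain ⟨A, j, hj, q, φ, rfl, hφ⟩ := exists_affine_chart s z
  obtain ⟨p, rfl⟩ := h.mem_open j.isOpenEmbedding.isOpen_range ⟨q, rfl⟩
  rw [j.isOpenEmbedding.isInducing.specializes_iff] at h
  rw [← ptDim_apply_of_isOpenImmersion, ← ptDim_apply_of_isOpenImmersion, hφ, ptDim_Spec,
    ptDim_Spec]
  have hp : p.asIdeal.IsPrime := PrimeSpectrum.isPrime p
  have hq : q.asIdeal.IsPrime := PrimeSpectrum.isPrime q
  refine RingHom.trdegENat_quotient_add_one_le _ _ _ (lt_of_le_of_ne ?_ fun e => ?_)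
  · exact (PrimeSpectrum.le_iff_specializes p q).2 h
  · exact hne (congrArg j (PrimeSpectrum.ext e))

theorem ptDim_lt_top [LocallyOfFiniteType s] (y : S) : ptDim s y < ⊤ := by
  obtain ⟨A, j, hj, p, φ, rfl, hφ⟩ := exists_affine_chart s y
  have h1 : LocallyOfFiniteType (Spec.map φ) := hφ ▸ inferInstance
  have h2 : φ.hom.FiniteType := (HasRingHomProperty.Spec_iff (P := @LocallyOfFiniteType)).1 h1
  rw [← ptDim_apply_of_isOpenImmersion, hφ, ptDim_Spec]
  algebraize [φ.hom]
  have h3 : Algebra.trdeg K (A ⧸ p.asIdeal) < Cardinal.aleph0 := trdeg_lt_aleph0_of_finiteType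
  have : Cardinal.toENat (Algebra.trdeg K (A ⧸ p.asIdeal)) < ⊤ := by
    rw [lt_top_iff_ne_top, Ne, Cardinal.toENat_eq_top, not_le]
    exact h3
  exact this

theorem ptDim_apply_of_isIntegralHom_of_isAffine [IsAffine T] [IsAffine S] (f : T ⟶ S)
    [IsIntegralHom f] (x : T) : ptDim (f ≫ s) x = ptDim s (f x) := by
  obtain ⟨φ, hφ⟩ := Spec.map_surjective (S.isoSpec.inv ≫ s)
  have h1 : s = S.isoSpec.hom ≫ Spec.map φ := by rw [hφ]; simp
  have h2 : f ≫ s = T.isoSpec.hom ≫ Spec.map (φ ≫ f.appTop) := by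
    rw [h1, Spec.map_comp, Scheme.isoSpec_hom_naturality_assoc]
  rw [h2, h1, ptDim_apply_of_isOpenImmersion, ptDim_apply_of_isOpenImmersion, ptDim_Spec,
    ptDim_Spec]
  have h3 : S.isoSpec.hom (f x) = Spec.map f.appTop (T.isoSpec.hom x) := by
    rw [← Scheme.Hom.comp_apply, ← Scheme.Hom.comp_apply, Scheme.isoSpec_hom_naturality]
  have h4 : f.appTop.hom.IsIntegral := f.isIntegral_app ⊤ (isAffineOpen_top S)
  rw [h3]
  generalize T.isoSpec.hom x = q
  have hq : q.asIdeal.IsPrime := PrimeSpectrum.isPrime q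
  let ψ := Ideal.quotientMap q.asIdeal f.appTop.hom (le_refl (q.asIdeal.comap f.appTop.hom))
  have h5 := RingHom.trdegENat_comp_of_isIntegral ((Ideal.Quotient.mk
    (q.asIdeal.comap f.appTop.hom)).comp φ.hom) ψ Ideal.quotientMap_injective fun y => ?_
  · exact h5
  · refine ⟨1, ?_, ?_⟩
    · exact one_ne_zero
    · rw [map_one, one_mul]
      exact RingHom.IsIntegral.quotient _ h4 y

end

section
variable {K : Type} [Field K] {S : Scheme.{0}} (s : S ⟶ Spec (.of K))

theorem topologicalKrullDim_le_of_ptDim_le {T : Type*} [TopologicalSpace T] {e : T → S}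
    (he : IsInducing e) (N : ℕ∞)
    (h : ∀ Z : Set T, IsIrreducible Z → IsClosed Z → ∀ ζ, IsGenericPoint ζ (closure (e '' Z)) →
      ptDim s ζ ≤ N) : topologicalKrullDim T ≤ N := by
  have irr (Z : IrreducibleCloseds T) : IsIrreducible (closure (e '' Z)) :=
    (Z.isIrreducible.image e he.continuous.continuousOn).closure
  refine Order.krullDim_le_of_add_one_le (fun Z => ptDim s (irr Z).genericPoint) N ?_ ?_
  · intro Z Z' hlt
    have g := (irr Z).isGenericPoint_genericPoint_closure
    have g' := (irr Z').isGenericPoint_genericPoint_closure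
    rw [closure_closure] at g g'
    have hsub : closure (e '' Z) ⊆ closure (e '' Z') := closure_mono (Set.image_mono hlt.le)
    refine ptDim_add_one_le_of_specializes s ?_ ?_
    · rw [g'.specializes_iff_mem]
      exact hsub g.mem
    · intro heq
      have h1 : closure (e '' Z) = closure (e '' Z') := by
        rw [← g.def, ← g'.def, heq]
      have h2 : closure (Z : Set T) = closure (Z' : Set T) := by
        rw [he.closure_eq_preimage_closure_image, he.closure_eq_preimage_closure_image, h1]
      rw [Z.isClosed.closure_eq, Z'.isClosed.closure_eq] at h2
      exact hlt.ne (SetLike.coe_injective h2)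
  · intro Z
    refine h Z Z.isIrreducible Z.isClosed _ ?_
    have g := (irr Z).isGenericPoint_genericPoint_closure
    rwa [closure_closure] at g

theorem ptDim_le_topologicalKrullDim [LocallyOfFiniteType s] {T : Type*} [TopologicalSpace T]
    {e : T → S} (he : IsInducing e) (y : S) (hy : closure {y} ∩ closedPoints S ⊆ Set.range e) :
    (ptDim s y : WithBot ℕ∞) ≤ topologicalKrullDim T := by
  have : JacobsonSpace S := LocallyOfFiniteType.jacobsonSpace s
  obtain ⟨A, j, hj, p, φ, rfl, hφ⟩ := exists_affine_chart s y
  have h1 : LocallyOfFiniteType (Spec.map φ) := hφ ▸ inferInstance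
  have h2 : φ.hom.FiniteType := (HasRingHomProperty.Spec_iff (P := @LocallyOfFiniteType)).1 h1
  have hp : p.asIdeal.IsPrime := PrimeSpectrum.isPrime p
  rw [← ptDim_apply_of_isOpenImmersion, hφ, ptDim_Spec]
  algebraize [φ.hom]
  refine (toENat_trdeg_le_ringKrullDim (K := K) (B := A ⧸ p.asIdeal)).trans ?_
  let k : PrimeSpectrum (A ⧸ p.asIdeal) → S :=
    fun Q => j (PrimeSpectrum.comap (Ideal.Quotient.mk p.asIdeal) Q)
  have hk : IsInducing k := j.isOpenEmbedding.isInducing.comp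
    (PrimeSpectrum.isClosedEmbedding_comap_of_surjective _ _
      Ideal.Quotient.mk_surjective).isInducing
  have hky (Q) : j p ⤳ k Q := by
    refine Specializes.map ?_ j.continuous
    refine (PrimeSpectrum.le_iff_specializes p _).1 ?_
    intro a ha
    change Ideal.Quotient.mk p.asIdeal a ∈ Q.asIdeal
    rw [Ideal.Quotient.eq_zero_iff_mem.2 ha]
    exact zero_mem _
  have hdense (Q) : closure (closure {k Q} ∩ Set.range e) = closure {k Q} := by
    refine (closure_minimal Set.inter_subset_left isClosed_closure).antisymm ?_
    refine subset_closure.trans (JacobsonSpace.closure_inter_closedPoints_eq_closure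
      (isClosed_closure (s := {k Q})).isLocallyClosed).ge |>.trans ?_
    refine closure_mono fun z hz => ⟨hz.1, hy ⟨?_, hz.2⟩⟩
    exact (hky Q).closure_subset hz.1
  let F : (PrimeSpectrum (A ⧸ p.asIdeal))ᵒᵈ → IrreducibleCloseds T := fun Q =>
    { carrier := e ⁻¹' closure {k (OrderDual.ofDual Q)}
      isIrreducible' := he.isIrreducible_preimage (isIrreducible_iff_closure.1 (by
        rw [hdense]; exact isIrreducible_singleton.closure))
      isClosed' := isClosed_closure.preimage he.continuous }
  have hF : StrictMono F := by
    intro Q Q' hlt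
    have hle : k (OrderDual.ofDual Q') ⤳ k (OrderDual.ofDual Q) := by
      rw [hk.specializes_iff]
      exact (PrimeSpectrum.le_iff_specializes _ _).1 hlt.le
    refine lt_of_le_not_ge (fun z hz => hle.closure_subset hz) fun hge => ?_
    have h3 : closure {k (OrderDual.ofDual Q')} ⊆ closure {k (OrderDual.ofDual Q)} := by
      rw [← hdense (OrderDual.ofDual Q')]
      refine closure_minimal ?_ isClosed_closure
      rintro _ ⟨hz, z, rfl⟩
      exact hge hz
    rw [← specializes_iff_closure_subset, hk.specializes_iff,
      ← PrimeSpectrum.le_iff_specializes] at h3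
    exact hlt.not_ge h3
  have := Order.krullDim_le_of_strictMono F hF
  rwa [Order.krullDim_orderDual] at this

end

section
variable {K : Type} [Field K] {Y Z : Scheme.{0}} (y : Y ⟶ Spec (.of K)) (z : Z ⟶ Spec (.of K))

theorem topologicalKrullDim_lt_of_ptDim_add_one_le {T : Type*} [TopologicalSpace T] {e : T → Z}
    (he : IsInducing e) (N : ℕ∞) (hN : N ≠ ⊤)
    (h : ∀ C : Set T, IsIrreducible C → IsClosed C → ∀ ζ, IsGenericPoint ζ (closure (e '' C)) →
      ptDim z ζ + 1 ≤ N) : topologicalKrullDim T < N := by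
  rcases isEmpty_or_nonempty T with hT | ⟨⟨t⟩⟩
  · have : IsEmpty (IrreducibleCloseds T) := ⟨fun C => hT.elim C.isIrreducible.nonempty.some⟩
    rw [topologicalKrullDim, Order.krullDim_eq_bot]
    exact WithBot.bot_lt_coe _
  · have irr : IsIrreducible (closure {t}) := isIrreducible_singleton.closure
    obtain ⟨ζ, hζ⟩ := QuasiSober.sober (irr.image e he.continuous.continuousOn).closure
      isClosed_closure
    have h1 : 1 ≤ N := le_add_self.trans (h _ irr isClosed_closure ζ hζ)
    obtain ⟨n, rfl⟩ := ENat.ne_top_iff_exists.1 hN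
    obtain ⟨n, rfl⟩ := Nat.exists_eq_add_of_le' (Nat.one_le_cast.1 h1)
    refine (topologicalKrullDim_le_of_ptDim_le z he n fun C hC hC' ζ hζ => ?_).trans_lt ?_
    · have := h C hC hC' ζ hζ
      push_cast at this
      exact (ENat.add_le_add_iff_right ENat.one_ne_top).1 this
    · exact WithBot.coe_lt_coe.2 (by exact_mod_cast Nat.lt_succ_self n)

/-- The image of a proper closed set of closed points of an irreducible variety has dimension
smaller than that of the variety. -/
theorem topologicalKrullDim_image_lt [LocallyOfFiniteType y] [QuasiCompact y] [IrreducibleSpace Y]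
    (Φ : Y ⟶ Z) (hΦ : Φ ≫ z = y) {TY TZ : Type*} [TopologicalSpace TY] [TopologicalSpace TZ]
    {eY : TY → Y} {eZ : TZ → Z} (hY : IsInducing eY) (hZ : IsInducing eZ)
    (hrange : closedPoints Y ⊆ Set.range eY) (φ : TY → TZ) (hφ : ∀ t, eZ (φ t) = Φ (eY t))
    (H : Set TY) (hH : IsClosed H) (hH' : H ≠ Set.univ) :
    topologicalKrullDim (φ '' H) < topologicalKrullDim TY := by
  have : IsLocallyNoetherian Y := LocallyOfFiniteType.isLocallyNoetherian y
  have : CompactSpace Y := QuasiCompact.compactSpace_of_compactSpace y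
  have : IsNoetherian Y := {}
  have : NoetherianSpace TY := hY.noetherianSpace
  have hφc : Continuous φ := by
    rw [hZ.continuous_iff, show eZ ∘ φ = Φ ∘ eY from funext hφ]
    exact Φ.continuous.comp hY.continuous
  have hη := genericPoint_spec Y
  have hlow := ptDim_le_topologicalKrullDim y hY (genericPoint Y)
    (Set.inter_subset_right.trans hrange)
  refine lt_of_lt_of_le ?_ hlow
  refine topologicalKrullDim_lt_of_ptDim_add_one_le z (e := fun t : φ '' H => eZ t)
    (hZ.comp IsInducing.subtypeVal) _ (ptDim_lt_top y _).ne fun C hC hC' ζ hζ => ?_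
  obtain ⟨D, hD, rfl⟩ := isClosed_induced_iff.1 hC'
  obtain ⟨S, hS, hScl, hSirr, hSeq⟩ := NoetherianSpace.exists_finite_set_isClosed_irreducible
    (hH.inter (hD.preimage hφc))
  have himg : (fun t : φ '' H => eZ t) '' (Subtype.val ⁻¹' D) =
      ⋃ P ∈ S, Φ '' (eY '' P) := by
    ext x
    simp only [Set.mem_iUnion, exists_prop]
    constructor
    · rintro ⟨⟨_, t, ht, rfl⟩, hD', rfl⟩
      obtain ⟨P, hP, htP⟩ := hSeq.le ⟨ht, hD'⟩
      exact ⟨P, hP, _, ⟨t, htP, rfl⟩, (hφ t).symm⟩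
    · rintro ⟨P, hP, _, ⟨t, htP, rfl⟩, rfl⟩
      obtain ⟨ht, htD⟩ := hSeq.ge ⟨P, hP, htP⟩
      exact ⟨⟨_, t, ht, rfl⟩, htD, hφ t⟩
  have hζ' := hζ.mem
  rw [himg, hS.closure_biUnion, Set.mem_iUnion₂] at hζ'
  obtain ⟨P, hP, hζP⟩ := hζ'
  obtain ⟨c, hc⟩ := QuasiSober.sober
    ((hSirr P hP).image eY hY.continuous.continuousOn).closure isClosed_closure
  have h1 : Φ c ⤳ ζ := by
    rw [specializes_iff_mem_closure]
    refine closure_minimal ?_ isClosed_closure hζP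
    rintro _ ⟨t, ht, rfl⟩
    exact ((hc.specializes (subset_closure ht)).map Φ.continuous).mem_closure
  have h2 : ζ ⤳ Φ c := by
    refine hζ.specializes ?_
    rw [himg]
    refine closure_mono (Set.subset_biUnion_of_mem (u := fun P => Φ '' (eY '' P)) hP) ?_
    exact image_closure_subset_closure_image Φ.continuous ⟨c, hc.mem, rfl⟩
  obtain rfl : ζ = Φ c := (h2.antisymm h1).eq
  have h3 : genericPoint Y ≠ c := by
    rintro rfl
    apply hH'
    rw [Set.eq_univ_iff_forall]
    intro t
    have h4 : closure P = Set.univ := by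
      rw [hY.closure_eq_preimage_closure_image, ← hc.def, hη.def, Set.preimage_univ]
    rw [(hScl P hP).closure_eq] at h4
    exact (hSeq.ge ⟨P, hP, h4 ▸ Set.mem_univ t⟩).1
  have h5 := ptDim_add_one_le_of_specializes y (hη.specializes (Set.mem_univ c)) h3
  refine le_trans (add_le_add_left ?_ 1) h5
  exact hΦ ▸ ptDim_apply_le z Φ c

/-- A proper morphism from an irreducible scheme having a fiber contained in an affine open
is generically finite. -/
theorem ptDim_genericPoint_of_fiber_subset [IsProper y] [IsSeparated z] [IrreducibleSpace Y]
    (Φ : Y ⟶ Z) (hΦ : Φ ≫ z = y) (U : Y.Opens) (hU : IsAffineOpen U) (a : Y)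
    (ha : Φ ⁻¹' {Φ a} ⊆ U) : ptDim z (Φ (genericPoint Y)) = ptDim y (genericPoint Y) := by
  have hprop : IsProper (Φ ≫ z) := hΦ ▸ ‹_›
  have hp : IsProper Φ := IsProper.of_comp Φ z
  have hcl : IsClosed (Φ '' (U : Set Y)ᶜ) := Φ.isClosedMap _ U.isOpen.isClosed_compl
  obtain ⟨W, hW, haW, hWU⟩ := exists_isAffineOpen_mem_and_subset (X := Z)
    (U := ⟨_, hcl.isOpen_compl⟩) (x := Φ a) (by rintro ⟨b, hb, hab⟩; exact hb (ha hab))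
  have hle : Φ ⁻¹ᵁ W ≤ U := fun b hb => by
    by_contra h
    exact hWU hb ⟨b, h, rfl⟩
  have : IsAffine U := hU
  have hUZ : IsAffineHom ((U.ι ≫ Φ) ≫ z) := inferInstance
  have hUZ' : IsAffineHom (U.ι ≫ Φ) :=
    MorphismProperty.of_postcomp (W := @IsAffineHom) (W' := @IsSeparated) _ z ‹_› hUZ
  have haff : IsAffineOpen (Φ ⁻¹ᵁ W) := by
    have := (hW.preimage (U.ι ≫ Φ)).image_of_isOpenImmersion U.ι
    convert this using 1
    ext b
    constructor
    · intro hb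
      exact ⟨⟨b, hle hb⟩, hb, rfl⟩
    · rintro ⟨b, hb, rfl⟩
      exact hb
  have : IsAffine W := hW
  have : IsAffine (Φ ⁻¹ᵁ W) := haff
  have hint : IsIntegralHom (Φ ∣_ W) :=
    IsIntegralHom.iff_universallyClosed_and_isAffineHom.2 ⟨inferInstance, inferInstance⟩
  have hη : genericPoint Y ∈ Φ ⁻¹ᵁ W :=
    ((genericPoint_spec Y).mem_open_set_iff (Φ ⁻¹ᵁ W).isOpen).2 ⟨a, trivial, haW⟩
  obtain ⟨x, hx⟩ : ∃ x : (Φ ⁻¹ᵁ W).toScheme, (Φ ⁻¹ᵁ W).ι x = genericPoint Y := ⟨⟨_, hη⟩, rfl⟩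
  have h3 := ptDim_apply_of_isIntegralHom_of_isAffine (W.ι ≫ z) (Φ ∣_ W) x
  have h4 : W.ι ((Φ ∣_ W) x) = Φ ((Φ ⁻¹ᵁ W).ι x) := by
    rw [← Scheme.Hom.comp_apply, morphismRestrict_ι, Scheme.Hom.comp_apply]
  rw [morphismRestrict_ι_assoc, hΦ, ptDim_apply_of_isOpenImmersion,
    ptDim_apply_of_isOpenImmersion, h4, hx] at h3
  exact h3.symm

/-- If a morphism from a complete irreducible variety has an image of smaller dimension, then
every nonempty fiber meets the complement of every affine open. -/
theorem exists_notMem_apply_eq_of_topologicalKrullDim_lt [IsProper y] [IsSeparated z]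
    [LocallyOfFiniteType z] [IrreducibleSpace Y]
    (Φ : Y ⟶ Z) (hΦ : Φ ≫ z = y) {TY TZ : Type*} [TopologicalSpace TY] [TopologicalSpace TZ]
    {eY : TY → Y} {eZ : TZ → Z} (hY : IsInducing eY) (hZ : IsInducing eZ)
    (hrange : Set.range eY = closedPoints Y) (hrangeZ : Set.range eZ ⊆ closedPoints Z)
    (φ : TY → TZ) (hφ : ∀ t, eZ (φ t) = Φ (eY t))
    (hdim : topologicalKrullDim (Set.range φ) < topologicalKrullDim TY)
    (U : Y.Opens) (hU : IsAffineOpen U) (c : TY) :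
    ∃ h : TY, eY h ∉ U ∧ eZ (φ h) = eZ (φ c) := by
  have : JacobsonSpace Y := LocallyOfFiniteType.jacobsonSpace y
  have hprop : IsProper (Φ ≫ z) := hΦ ▸ ‹_›
  have hp : IsProper Φ := IsProper.of_comp Φ z
  by_contra! hne
  have hη := genericPoint_spec Y
  have hcl : IsClosed (Φ ⁻¹' {Φ (eY c)}) :=
    IsClosed.preimage Φ.continuous (by rw [← hφ]; exact hrangeZ ⟨_, rfl⟩)
  have hfib : Φ ⁻¹' {Φ (eY c)} ⊆ U := by
    by_contra hsub
    obtain ⟨b, hb, hbc⟩ := nonempty_inter_closedPoints (Z := Φ ⁻¹' {Φ (eY c)} ∩ (U : Set Y)ᶜ)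
      (Set.inter_compl_nonempty_iff.2 hsub) (hcl.inter U.isOpen.isClosed_compl).isLocallyClosed
    obtain ⟨t, rfl⟩ := hrange.ge hbc
    exact hne t hb.2 (by rw [hφ, hφ]; exact hb.1)
  have hd := ptDim_genericPoint_of_fiber_subset y z Φ hΦ U hU _ hfib
  refine hdim.not_ge ?_
  calc topologicalKrullDim TY ≤ ptDim y (genericPoint Y) := by
        refine topologicalKrullDim_le_of_ptDim_le y hY _ fun C _ _ ζ _ => ?_
        by_cases h : genericPoint Y = ζ
        · rw [h]
        · exact le_self_add.trans
            (ptDim_add_one_le_of_specializes y (hη.specializes (Set.mem_univ ζ)) h)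
    _ = ptDim z (Φ (genericPoint Y)) := by rw [hd]
    _ ≤ _ := by
        refine ptDim_le_topologicalKrullDim z (e := fun t : Set.range φ => eZ t)
          (hZ.comp IsInducing.subtypeVal) _ ?_
        rintro w ⟨hw, hwc⟩
        have h1 : IsClosed (Set.range Φ) := Φ.isClosedMap.isClosed_range
        obtain ⟨b, rfl⟩ := closure_minimal (Set.singleton_subset_iff.2 (Set.mem_range_self _)) h1 hw
        obtain ⟨b', hb, hbc⟩ := nonempty_inter_closedPoints (Z := Φ ⁻¹' {Φ b})
          (⟨b, rfl⟩ : (Φ ⁻¹' {Φ b}).Nonempty) (IsClosed.preimage Φ.continuous hwc).isLocallyClosed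
        obtain ⟨t, rfl⟩ := hrange.ge hbc
        exact ⟨⟨φ t, t, rfl⟩, (hφ t).trans hb⟩

end

end AlgebraicGeometry.Scheme

/-- A multiplicative morphism property stable under base change passes to finite products
over a base. -/
theorem CategoryTheory.Over.prop_piObj_hom {C : Type*} [Category* C] [HasPullbacks C] {S : C}
    (P : MorphismProperty C) [P.IsMultiplicative] [P.IsStableUnderBaseChange]
    [HasFiniteProducts (Over S)] {J : Type*} [Finite J] (F : J → Over S) (h : ∀ j, P (F j).hom) :
    P (∏ᶜ F).hom := by
  let Q : ObjectProperty (Over S) := fun X => P X.hom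
  have hiso {X Y : Over S} (e : X ≅ Y) (hX : Q X) : Q Y := by
    have : IsIso e.inv.left := inferInstanceAs (IsIso ((Over.forget S).map e.inv))
    have : P (e.inv.left ≫ X.hom) := (P.cancel_left_of_respectsIso _ _).2 hX
    rwa [Over.w] at this
  have h0 : Q.IsClosedUnderLimitsOfShape (Discrete.{0} PEmpty) := by
    refine ⟨fun X ⟨p⟩ => ?_⟩
    have hX : IsTerminal X :=
      (IsLimit.equivOfNatIsoOfIso p.diag.uniqueFromEmpty _ _
        (by exact Cone.ext (Iso.refl _) (by rintro ⟨⟨⟩⟩))).1 p.isLimit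
    exact hiso (IsTerminal.uniqueUpToIso Over.mkIdTerminal hX) (P.id_mem S)
  have h2 : Q.IsClosedUnderBinaryProducts := by
    refine ⟨fun X ⟨p⟩ => ?_⟩
    let A := p.diag.obj ⟨.left⟩
    let B := p.diag.obj ⟨.right⟩
    have hAB : P ((A ⨯ B).hom) := by
      have h1 : P (pullback.fst A.hom B.hom ≫ A.hom) :=
        P.comp_mem _ _ (P.pullback_fst _ _ (p.prop_diag_obj _)) (p.prop_diag_obj _)
      have h2 := (P.cancel_left_of_respectsIso (Over.prodLeftIsoPullback A B).hom _).2 h1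
      rwa [Over.prodLeftIsoPullback_hom_fst_assoc, Over.w] at h2
    exact hiso (HasLimit.isoOfNatIso (diagramIsoPair p.diag).symm ≪≫
      (p.isLimit.conePointUniqueUpToIso (limit.isLimit _)).symm) hAB
  have := ObjectProperty.IsClosedUnderFiniteProducts.mk' (P := Q)
  exact Q.prop_product h

theorem preirreducibleSpace_pi_of_continuous_update {ι A : Type*} [Finite ι] [DecidableEq ι]
    [TopologicalSpace A] [PreirreducibleSpace A] (t : TopologicalSpace (ι → A))
    (h : ∀ (u : ι → A) (i : ι), Continuous (Function.update u i)) :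
    PreirreducibleSpace (ι → A) := by
  have := Fintype.ofFinite ι
  refine ⟨fun U W hU hW ⟨u, _, hu⟩ ⟨w, _, hw⟩ => ?_⟩
  have key (S : Finset ι) : ∃ u ∈ U, ∃ w ∈ W, ∀ i ∈ S, u i = w i := by
    induction S using Finset.induction_on with
    | empty => exact ⟨u, hu, w, hw, by simp⟩
    | insert i S _ ih =>
      obtain ⟨u, hu, w, hw, hS⟩ := ih
      obtain ⟨a, -, hau, haw⟩ := PreirreducibleSpace.isPreirreducible_univ
        (Function.update u i ⁻¹' U) (Function.update w i ⁻¹' W)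
        (hU.preimage (h u i)) (hW.preimage (h w i))
        ⟨u i, trivial, by simpa⟩ ⟨w i, trivial, by simpa⟩
      refine ⟨_, hau, _, haw, fun j hj => ?_⟩
      by_cases hji : j = i
      · subst hji
        simp
      · simpa [hji] using hS j (Finset.mem_of_mem_insert_of_ne hj hji)
  obtain ⟨u, hu, w, hw, huw⟩ := key Finset.univ
  obtain rfl : u = w := funext fun i => huw i (Finset.mem_univ i)
  exact ⟨u, trivial, hu, hw⟩

noncomputable section

namespace GOE

/-! ## Varieties over a field and their points -/

variable (K : Type) [Field K]

variable (V : Over (SpecK K))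

/-! ## Configurations, restrictions, cylinders -/

variable {G : Type} [Group G]

section Points
variable {K} {W : Over (SpecK K)}

theorem ev_eq_closedPoint (a : Pt K W) : ev K a = a.left (IsLocalRing.closedPoint K) :=
  congrArg a.left (Subsingleton.elim (α := PrimeSpectrum K) _ _)

theorem ev_injective [IsAlgClosed K] [LocallyOfFiniteType W.hom] :
    Function.Injective (ev K (W := W)) := by
  intro a b h
  rw [ev_eq_closedPoint, ev_eq_closedPoint] at h
  exact Over.OverMorphism.ext (ext_of_apply_closedPoint_eq W.hom (Over.w a) (Over.w b) h)

theorem range_ev [IsAlgClosed K] [LocallyOfFiniteType W.hom] :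
    Set.range (ev K (W := W)) = closedPoints W.left := by
  ext x
  constructor
  · rintro ⟨a, rfl⟩
    rw [ev_eq_closedPoint]
    exact (pointEquivClosedPoint W.hom ⟨a.left, Over.w a⟩).2
  · intro hx
    refine ⟨Over.homMk (pointOfClosedPoint W.hom x hx) (pointOfClosedPoint_comp _ _ _), ?_⟩
    exact pointOfClosedPoint_apply W.hom x hx _

theorem ev_comp {W' : Over (SpecK K)} (a : Pt K W) (f : W ⟶ W') :
    ev K (a ≫ f) = f.left (ev K a) := rfl

end Points

section Powers
variable {V} {Ω : Type} [Finite Ω]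

/-- The projection of a power onto one of its factors. -/
def projPow (i : Ω) : pow K V Ω ⟶ V := Pi.π _ i

variable {W : Over (SpecK K)}

/-- The morphism to a power with given components. -/
def liftPow (g : Ω → (W ⟶ V)) : W ⟶ pow K V Ω := Pi.lift g

theorem liftPow_projPow (g : Ω → (W ⟶ V)) (i : Ω) : liftPow K g ≫ projPow K i = g i :=
  Pi.lift_π g i

theorem ptPow_projPow (u : Ω → Pt K V) (i : Ω) : ptPow K V Ω u ≫ projPow K i = u i :=
  Pi.lift_π u i

variable {K} in
theorem hom_pow_ext {a b : W ⟶ pow K V Ω} (h : ∀ i, a ≫ projPow K i = b ≫ projPow K i) : a = b :=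
  Pi.hom_ext _ _ h

theorem ptPow_eq_comp_liftPow (g : Ω → (W ⟶ V)) (w : Pt K W) (u : Ω → Pt K V)
    (h : ∀ i, w ≫ g i = u i) : ptPow K V Ω u = w ≫ liftPow K g :=
  hom_pow_ext fun i => by rw [Category.assoc, liftPow_projPow, h, ptPow_projPow]

theorem ptPow_bijective : Function.Bijective (ptPow K V Ω) :=
  Function.bijective_iff_has_inverse.2 ⟨fun b i => b ≫ projPow K i,
    fun u => funext fun i => ptPow_projPow K u i,
    fun _ => hom_pow_ext fun i => ptPow_projPow K _ i⟩

theorem locallyOfFiniteType_pow [LocallyOfFiniteType V.hom] :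
    LocallyOfFiniteType (pow K V Ω).hom :=
  Over.prop_piObj_hom @LocallyOfFiniteType _ fun _ => ‹_›

theorem quasiCompact_pow [QuasiCompact V.hom] : QuasiCompact (pow K V Ω).hom :=
  Over.prop_piObj_hom @QuasiCompact _ fun _ => ‹_›

theorem isProper_pow [IsProper V.hom] : IsProper (pow K V Ω).hom :=
  Over.prop_piObj_hom @IsProper _ fun _ => ‹_›

theorem range_ev_ptPow [IsAlgClosed K] [LocallyOfFiniteType V.hom] :
    Set.range (fun u => ev K (ptPow K V Ω u)) = closedPoints (pow K V Ω).left := by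
  have := locallyOfFiniteType_pow K (V := V) (Ω := Ω)
  rw [← range_ev, ← (ptPow_bijective K (V := V) (Ω := Ω)).2.range_comp]
  rfl

theorem ev_ptPow_injective [IsAlgClosed K] [LocallyOfFiniteType V.hom] :
    Function.Injective (fun u => ev K (ptPow K V Ω u)) := by
  have := locallyOfFiniteType_pow K (V := V) (Ω := Ω)
  exact ev_injective.comp (ptPow_bijective K).1

end Powers

section Substitution
variable {V} {Ω : Type} [Finite Ω] {W : Over (SpecK K)}

/-- The constant morphism with value a given `K`-point. -/
def constHom (W : Over (SpecK K)) (a : Pt K V) : W ⟶ V := Over.mkIdTerminal.from W ≫ a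

theorem comp_constHom (w : Pt K W) (a : Pt K V) : w ≫ constHom K W a = a := by
  rw [constHom, ← Category.assoc, Over.mkIdTerminal.hom_ext (w ≫ _) (𝟙 _), Category.id_comp]

theorem irreducibleSpace_pow [IsAlgClosed K] [LocallyOfFiniteType V.hom]
    [IrreducibleSpace V.left] : IrreducibleSpace (pow K V Ω).left := by
  classical
  have := locallyOfFiniteType_pow K (V := V) (Ω := Ω)
  have : JacobsonSpace V.left := LocallyOfFiniteType.jacobsonSpace V.hom
  have : JacobsonSpace (pow K V Ω).left := LocallyOfFiniteType.jacobsonSpace (pow K V Ω).hom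
  let : TopologicalSpace (Pt K V) := .induced (ev K) inferInstance
  let := cfgTop K V Ω
  have hA : IsIrreducible (Set.univ : Set (Pt K V)) := by
    refine IsInducing.isIrreducible_preimage (f := ev K) ⟨rfl⟩ (s := Set.univ) ?_
    rw [Set.univ_inter, range_ev, ← isIrreducible_iff_closure, closure_closedPoints]
    exact IrreducibleSpace.isIrreducible_univ _
  have : PreirreducibleSpace (Pt K V) := ⟨hA.2⟩
  obtain ⟨a, -⟩ := hA.1
  have := preirreducibleSpace_pi_of_continuous_update (cfgTop K V Ω) fun u i => by
    let g : Ω → (V ⟶ V) := fun j => if j = i then 𝟙 V else constHom K V (u j)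
    refine continuous_induced_rng.2 ?_
    refine Continuous.congr (f := (liftPow K g).left ∘ ev K)
      (Scheme.Hom.continuous _ |>.comp continuous_induced_dom) fun w => ?_
    rw [Function.comp_apply, Function.comp_apply, ptPow_eq_comp_liftPow K g w, ev_comp]
    intro j
    by_cases h : j = i
    · subst h
      simp [g]
    · simp [g, h, comp_constHom]
  have hirr : IsIrreducible (Set.univ : Set (Ω → Pt K V)) :=
    ⟨⟨fun _ => a, trivial⟩, PreirreducibleSpace.isPreirreducible_univ⟩
  have := (hirr.image (fun u => ev K (ptPow K V Ω u)) continuous_induced_dom.continuousOn).closure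
  rw [Set.image_univ, range_ev_ptPow, closure_closedPoints] at this
  have h' : PreirreducibleSpace (pow K V Ω).left := ⟨this.2⟩
  exact { toNonempty := ⟨this.1.some⟩ }

end Substitution

section Cylinders
variable {K V} {Ω Λ : Finset G} {τ : (G → Pt K V) → (G → Pt K V)}

open Classical in
/-- The configuration equal to `u` on `Ω` and to `p` outside of `Ω`. -/
def glue (p : {g : G // g ∉ Ω} → Pt K V) (u : ↥Ω → Pt K V) : G → Pt K V :=
  fun g => if h : g ∈ Ω then u ⟨g, h⟩ else p ⟨g, h⟩

theorem glue_of_notMem {G : Type} {Ω : Finset G} (p : {g : G // g ∉ Ω} → Pt K V)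
    (u : ↥Ω → Pt K V) {g : G} (h : g ∉ Ω) : glue p u g = p ⟨g, h⟩ := dif_neg h

theorem cyl_eq_image_glue {G : Type} {Ω : Finset G} (D : Set (↥Ω → Pt K V))
    (p : {g : G // g ∉ Ω} → Pt K V) : cyl K V Ω D p = glue p '' D := by
  ext c
  constructor
  · rintro ⟨hD, hp⟩
    refine ⟨_, hD, funext fun g => ?_⟩
    by_cases h : g ∈ Ω
    · simp [glue, h]
    · simp [glue, h, hp]
  · rintro ⟨u, hu, rfl⟩
    refine ⟨?_, fun g h => glue_of_notMem p u h⟩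
    convert hu using 1
    funext ω
    simp [glue]

/-- The image of a pattern under `τ`, completed by `p` and observed on `Λ`. -/
def patternMap (τ : (G → Pt K V) → (G → Pt K V)) (p : {g : G // g ∉ Ω} → Pt K V) (Λ : Finset G)
    (u : ↥Ω → Pt K V) : ↥Λ → Pt K V := fun l => τ (glue p u) l

theorem IsAlgCA.exists_hom (hτ : IsAlgCA K V τ) (p : {g : G // g ∉ Ω} → Pt K V) (Λ : Finset G) :
    ∃ Φ : pow K V ↥Ω ⟶ pow K V ↥Λ, ∀ u,
      ev K (ptPow K V ↥Λ (patternMap τ p Λ u)) = Φ.left (ev K (ptPow K V ↥Ω u)) := by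
  classical
  obtain ⟨M, f, hf⟩ := hτ
  let k (l : ↥Λ) (m : ↥M) : pow K V ↥Ω ⟶ V :=
    if h : (l * m : G) ∈ Ω then projPow K ⟨_, h⟩ else constHom K _ (p ⟨_, h⟩)
  refine ⟨liftPow K fun l => liftPow K (k l) ≫ f, fun u => ?_⟩
  rw [ptPow_eq_comp_liftPow K (fun l => liftPow K (k l) ≫ f) (ptPow K V ↥Ω u), ev_comp]
  intro l
  rw [patternMap, hf, ptPow_eq_comp_liftPow K (k l) (ptPow K V ↥Ω u), Category.assoc]
  intro m
  by_cases h : (l * m : G) ∈ Ω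
  · simp only [k, glue, dif_pos h, ptPow_projPow]
  · simp only [k, glue, dif_neg h, comp_constHom]

theorem IsAlgCA.exists_eq_of_notMem (hτ : IsAlgCA K V τ) (Ω : Finset G) :
    ∃ Λ : Finset G, ∀ (p : {g : G // g ∉ Ω} → Pt K V) (u v : ↥Ω → Pt K V), ∀ g ∉ Λ,
      τ (glue p u) g = τ (glue p v) g := by
  classical
  obtain ⟨M, f, hf⟩ := hτ
  refine ⟨Finset.image₂ (fun ω m => ω * m⁻¹) Ω M, fun p u v g hg => ?_⟩
  have h (m : ↥M) : g * (m : G) ∉ Ω := fun hm =>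
    hg (Finset.mem_image₂.2 ⟨_, hm, m, m.2, mul_inv_cancel_right _ _⟩)
  simp only [hf, glue_of_notMem _ _ (h _)]

theorem cfgDim_univ (Ω : Type) [Finite Ω] :
    cfgDim K V Ω Set.univ = @topologicalKrullDim _ (cfgTop K V Ω) :=
  letI := cfgTop K V Ω
  (Homeomorph.Set.univ _).isHomeomorph.topologicalKrullDim_eq

variable [IsAlgClosed K] [IrreducibleSpace V.left]

theorem IsAlgCA.cfgDim_patternMap_image_lt [LocallyOfFiniteType V.hom] [QuasiCompact V.hom]
    (hτ : IsAlgCA K V τ)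
    (p : {g : G // g ∉ Ω} → Pt K V) (Λ : Finset G) {H : Set (↥Ω → Pt K V)}
    (hH : cfgClosed K V ↥Ω H) (hH' : H ≠ Set.univ) :
    cfgDim K V ↥Λ (patternMap τ p Λ '' H) < cfgDim K V ↥Ω Set.univ := by
  obtain ⟨Φ, hΦ⟩ := hτ.exists_hom p Λ
  have := locallyOfFiniteType_pow K (V := V) (Ω := ↥Ω)
  have := quasiCompact_pow K (V := V) (Ω := ↥Ω)
  have := irreducibleSpace_pow K (V := V) (Ω := ↥Ω)
  let := cfgTop K V ↥Ω
  let := cfgTop K V ↥Λ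
  rw [cfgDim_univ]
  exact Scheme.topologicalKrullDim_image_lt (pow K V ↥Ω).hom (pow K V ↥Λ).hom Φ.left (Over.w Φ)
    (eY := fun u => ev K (ptPow K V ↥Ω u)) (eZ := fun u => ev K (ptPow K V ↥Λ u))
    ⟨rfl⟩ ⟨rfl⟩ (range_ev_ptPow K).ge _ hΦ H hH hH'

theorem IsAlgCA.exists_patternMap_eq [IsProper V.hom] (hτ : IsAlgCA K V τ)
    (p : {g : G // g ∉ Ω} → Pt K V) (Λ : Finset G)
    (h : cfgDim K V ↥Λ (Set.range (patternMap τ p Λ)) < cfgDim K V ↥Ω Set.univ)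
    {U : (pow K V ↥Ω).left.Opens} (hU : IsAffineOpen U) (c : ↥Ω → Pt K V) :
    ∃ b, ev K (ptPow K V ↥Ω b) ∉ U ∧ patternMap τ p Λ b = patternMap τ p Λ c := by
  obtain ⟨Φ, hΦ⟩ := hτ.exists_hom p Λ
  have := isProper_pow K (V := V) (Ω := ↥Ω)
  have := isProper_pow K (V := V) (Ω := ↥Λ)
  have := irreducibleSpace_pow K (V := V) (Ω := ↥Ω)
  let := cfgTop K V ↥Ω
  let := cfgTop K V ↥Λ
  rw [cfgDim_univ] at h
  obtain ⟨b, hb, hbc⟩ := Scheme.exists_notMem_apply_eq_of_topologicalKrullDim_lt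
    (pow K V ↥Ω).hom (pow K V ↥Λ).hom Φ.left (Over.w Φ)
    (eY := fun u => ev K (ptPow K V ↥Ω u)) (eZ := fun u => ev K (ptPow K V ↥Λ u))
    ⟨rfl⟩ ⟨rfl⟩ (range_ev_ptPow K) (range_ev_ptPow K).le _ hΦ h U hU c
  exact ⟨b, hb, ev_ptPow_injective K hbc⟩

theorem IsAlgCA.starPreInjective [LocallyOfFiniteType V.hom] [QuasiCompact V.hom]
    (hτ : IsAlgCA K V τ)
    (h : StarStarPreInjective K V τ) : StarPreInjective K V τ := by
  rintro ⟨Ω, H, hH, hH', heq⟩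
  refine h ⟨Ω, fun p => ?_⟩
  obtain ⟨c₀, -⟩ := (Set.ne_univ_iff_exists_notMem H).1 hH'
  obtain ⟨Λ, hΛ⟩ := hτ.exists_eq_of_notMem Ω
  refine ⟨Λ, patternMap τ p Λ '' H, fun g => τ (glue p c₀) g, ?_,
    hτ.cfgDim_patternMap_image_lt p Λ hH hH'⟩
  rw [heq, cyl_eq_image_glue, Set.image_image]
  ext c
  constructor
  · rintro ⟨u, hu, rfl⟩
    exact ⟨⟨u, hu, rfl⟩, fun g hg => hΛ p u c₀ g hg⟩
  · rintro ⟨⟨u, hu, huc⟩, hc⟩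
    refine ⟨u, hu, funext fun g => ?_⟩
    by_cases hg : g ∈ Λ
    · exact congrFun huc ⟨g, hg⟩
    · exact (hΛ p u c₀ g hg).trans (hc g hg).symm

theorem IsAlgCA.starStarPreInjective [IsProper V.hom] (hτ : IsAlgCA K V τ)
    (h : StarPreInjective K V τ) : StarStarPreInjective K V τ := by
  rintro ⟨Ω, hΩ⟩
  have := locallyOfFiniteType_pow K (V := V) (Ω := ↥Ω)
  have := irreducibleSpace_pow K (V := V) (Ω := ↥Ω)
  have : JacobsonSpace (pow K V ↥Ω).left := LocallyOfFiniteType.jacobsonSpace (pow K V ↥Ω).hom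
  obtain ⟨x⟩ : Nonempty (pow K V ↥Ω).left := inferInstance
  obtain ⟨U, hU, hxU, -⟩ := exists_isAffineOpen_mem_and_subset (U := ⊤)
    (TopologicalSpace.Opens.mem_top x)
  refine h ⟨Ω, {u | ev K (ptPow K V ↥Ω u) ∉ U}, ?_, ?_, fun p => ?_⟩
  · let := cfgTop K V ↥Ω
    exact U.isOpen.isClosed_compl.preimage continuous_induced_dom
  · obtain ⟨y, hyU, hy⟩ := nonempty_inter_closedPoints ⟨x, hxU⟩ U.isOpen.isLocallyClosed
    rw [← range_ev_ptPow K] at hy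
    obtain ⟨u, rfl⟩ := hy
    exact fun hu => hu.ge (Set.mem_univ u) hyU
  · obtain ⟨Λ, R, s, hR, hdim⟩ := hΩ p
    rw [cyl_eq_image_glue, cyl_eq_image_glue, Set.image_image, Set.image_image]
    rw [cyl_eq_image_glue, Set.image_image, Set.image_univ] at hR
    have hmem (u) : τ (glue p u) ∈ cyl K V Λ R s := hR.le ⟨u, rfl⟩
    have hrange : Set.range (patternMap τ p Λ) = R := by
      refine (Set.range_subset_iff.2 fun u => (hmem u).1).antisymm fun r hr => ?_
      obtain ⟨u, hu⟩ := hR.ge ((cyl_eq_image_glue R s).ge ⟨r, hr, rfl⟩)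
      exact ⟨u, funext fun l => by simp [hu, glue]⟩
    refine Set.Subset.antisymm ?_ (Set.image_mono (Set.subset_univ _))
    rintro _ ⟨c, -, rfl⟩
    obtain ⟨b, hb, hbc⟩ := hτ.exists_patternMap_eq p Λ (hrange ▸ hdim) hU c
    refine ⟨b, hb, funext fun g => ?_⟩
    by_cases hg : g ∈ Λ
    · exact congrFun hbc ⟨g, hg⟩
    · exact ((hmem b).2 g hg).trans ((hmem c).2 g hg).symm

end Cylinders

/-- Proposition 6.5.(ii) and (iii). Let `G` be a group, `X` an
algebraic variety over an algebraically closed field `K`, `A := X(K)`, and `τ` an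
algebraic cellular automaton over `(G,X,K)`. (i) If `X` is irreducible and `τ` is
`(**)`-pre-injective, then `τ` is `(*)`-pre-injective; (ii) if `X` is irreducible and
complete over `K`, then `τ` is `(*)`-pre-injective iff it is `(**)`-pre-injective. -/
theorem star_starStar_relations
    (G : Type) [Group G]
    (K : Type) [Field K] [IsAlgClosed K]
    (V : Over (SpecK K)) (hft : LocallyOfFiniteType V.hom) (hqc : QuasiCompact V.hom)
    (τ : (G → Pt K V) → (G → Pt K V)) (hca : IsAlgCA K V τ) :
    (IrreducibleSpace V.left →
      (StarStarPreInjective K V τ → StarPreInjective K V τ)) ∧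
    (IrreducibleSpace V.left → IsProper V.hom →
      (StarPreInjective K V τ ↔ StarStarPreInjective K V τ)) := by
  exact ⟨fun _ h => hca.starPreInjective h,
    fun _ _ => ⟨fun h => hca.starStarPreInjective h, fun h => hca.starPreInjective h⟩⟩

end GOE
end
end
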